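/- Let P(x, y) and Q(x, y) be bivariate polynomials in ℝ[x, y] of degree at most δ, each depending non-trivially on both x and y (i.e., P, Q ∈ ℝ[x, y] \ (ℝ[x] ∪ ℝ[y])). Suppose that NEITHER of the following holds: (i) P(x, y) = f(u_1(x) + u_2(y)) and Q(x, y) = g(v_1(x) + v_2(y)) for some nonconstant univariate real polynomials f, g, u_1, u_2, v_1, v_2 with u_1 ≡_a v_1 and u_2 ≡_a v_2; (ii) P(x, y) = f(u_1(x)·u_2(y)) and Q(x, y) = g(v_1(x)·v_2(y)) for some nonconstant univariate real polynomials f, g, u_1, u_2, v_1, v_2 with u_1 ≡_m v_1 and u_2 ≡_m v_2. Then there exists a constant c > 0 depending only on δ such that for all n ∈ ℕ and all finite sets A, B ⊂ ℝ with |A| = |B| = n, max{|P(A, B)|, |Q(A, B)|} ≥ c · n^{5/4}. -/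

import Mathlib

open Polynomial Pointwise

noncomputable section

/-- `p ≡_a q` : there is a nonzero real `λ` with `p(x) = λ q(x)` for all real `x`. -/
def EquivA (p q : Polynomial ℝ) : Prop :=
  ∃ l : ℝ, l ≠ 0 ∧ ∀ x : ℝ, p.eval x = l * q.eval x

/-- `p ≡_m q` : there is a positive rational `κ` with `|p(x)| = |q(x)|^κ` for all real `x`. -/
def EquivM (p q : Polynomial ℝ) : Prop :=
  ∃ k : ℚ, 0 < k ∧ ∀ x : ℝ, |p.eval x| = |q.eval x| ^ (k : ℝ)


/-- rank of `s` in `S` -/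
def rk (S : Finset ℝ) (s : ℝ) : ℕ := (S.filter (fun x => x < s)).card

lemma rk_mono (S : Finset ℝ) {u v : ℝ} (h : u ≤ v) : rk S u ≤ rk S v := by
  unfold rk
  apply Finset.card_le_card
  intro x hx
  simp only [Finset.mem_filter] at hx ⊢
  exact ⟨hx.1, lt_of_lt_of_le hx.2 h⟩

lemma rk_strict (S : Finset ℝ) {u v : ℝ} (hu : u ∈ S) (h : u < v) : rk S u < rk S v := by
  unfold rk
  apply Finset.card_lt_card
  rw [Finset.ssubset_iff_of_subset]
  · exact ⟨u, by simp [hu, h], by simp⟩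
  · intro x hx
    simp only [Finset.mem_filter] at hx ⊢
    exact ⟨hx.1, lt_trans hx.2 h⟩

lemma rk_inj (S : Finset ℝ) : Set.InjOn (rk S) S := by
  intro u hu v hv h
  rcases lt_trichotomy u v with h1 | h1 | h1
  · have := rk_strict S hu h1; omega
  · exact h1
  · have := rk_strict S hv h1; omega

lemma rk_lt (S : Finset ℝ) {u : ℝ} (hu : u ∈ S) : rk S u < S.card := by
  unfold rk
  apply Finset.card_lt_card
  rw [Finset.ssubset_iff_of_subset (Finset.filter_subset _ _)]
  exact ⟨u, hu, by simp⟩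

lemma rk_image (S : Finset ℝ) : S.image (rk S) = Finset.range S.card := by
  apply Finset.eq_of_subset_of_card_le
  · intro k hk
    simp only [Finset.mem_image] at hk
    obtain ⟨u, hu, rfl⟩ := hk
    simpa using rk_lt S hu
  · rw [Finset.card_image_of_injOn (rk_inj S)]; simp

/-- cell index -/
def cell (S : Finset ℝ) (L : ℕ) (s : ℝ) : ℕ := rk S s / L

lemma cell_card (S : Finset ℝ) (L : ℕ) (hL : 0 < L) (s : ℝ) :
    (S.filter (fun x => cell S L x = cell S L s)).card ≤ L := by
  have : (S.filter (fun x => cell S L x = cell S L s)).card ≤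
      (Finset.Ico (L * cell S L s) (L * cell S L s + L)).card := by
    apply Finset.card_le_card_of_injOn (rk S)
    · intro x hx
      simp only [Finset.coe_filter, Set.mem_ofPred_eq] at hx
      rw [← hx.2]
      simp only [Finset.coe_Ico, Set.mem_Ico, cell]
      have := Nat.div_add_mod (rk S x) L
      have := Nat.mod_lt (rk S x) hL
      omega
    · exact (rk_inj S).mono (by intro x hx; simp at hx; exact hx.1)
  simpa using this

def pairsS (S : Finset ℝ) (L : ℕ) : Finset (ℝ × ℝ) :=
  (S ×ˢ S).filter (fun z => cell S L z.2 = cell S L z.1)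

lemma pairsS_card (S : Finset ℝ) (L : ℕ) (hL : 0 < L) : (pairsS S L).card ≤ S.card * L := by
  unfold pairsS
  rw [Finset.card_filter, Finset.sum_product]
  calc _ = ∑ x ∈ S, (S.filter (fun y => cell S L y = cell S L x)).card := by
        apply Finset.sum_congr rfl
        intro x _
        rw [Finset.card_filter]
    _ ≤ ∑ x ∈ S, L := Finset.sum_le_sum (fun x _ => cell_card S L hL x)
    _ = _ := by simp

def thr (S : Finset ℝ) (L : ℕ) : Finset ℝ :=
  S.filter (fun x => L ∣ rk S x ∧ 0 < rk S x)

lemma thr_card (S : Finset ℝ) (L : ℕ) (hL : 0 < L) : (thr S L).card ≤ S.card / L := by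
  have : (thr S L).card ≤ (Finset.Icc 1 (S.card / L)).card := by
    apply Finset.card_le_card_of_injOn (fun x => rk S x / L)
    · intro x hx
      simp only [thr, Finset.coe_filter, Set.mem_ofPred_eq] at hx
      simp only [Finset.coe_Icc, Set.mem_Icc]
      refine ⟨?_, Nat.div_le_div_right (rk_lt S hx.1).le⟩
      exact (Nat.one_le_div_iff hL).2 (Nat.le_of_dvd hx.2.2 hx.2.1)
    · intro x hx y hy h
      simp only [thr, Finset.coe_filter, Set.mem_ofPred_eq] at hx hy
      apply rk_inj S hx.1 hy.1
      simp only at h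
      obtain ⟨k, hk⟩ := hx.2.1
      obtain ⟨l, hl⟩ := hy.2.1
      rw [hk, hl, Nat.mul_div_cancel_left _ hL, Nat.mul_div_cancel_left _ hL] at h
      rw [hk, hl, h]
  simpa using this

lemma thr_sep (S : Finset ℝ) (L : ℕ) (hL : 0 < L) {u v : ℝ} (hv : v ∈ S)
    (h : cell S L u < cell S L v) : ∃ θ ∈ thr S L, u < θ ∧ θ ≤ v := by
  have h1 : L * cell S L v ≤ rk S v := Nat.mul_div_le _ _
  have h2 : L * cell S L v ∈ S.image (rk S) := by
    rw [rk_image]; simpa using lt_of_le_of_lt h1 (rk_lt S hv)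
  simp only [Finset.mem_image] at h2
  obtain ⟨θ, hθ, hθ2⟩ := h2
  have hlt : rk S u < L * cell S L v := by
    have := Nat.div_add_mod (rk S u) L
    have := Nat.mod_lt (rk S u) hL
    have h3 : L * (cell S L u + 1) ≤ L * cell S L v := Nat.mul_le_mul_left _ h
    unfold cell at *
    rw [mul_add] at h3
    omega
  refine ⟨θ, ?_, ?_, ?_⟩
  · simp only [thr, Finset.mem_filter]
    exact ⟨hθ, hθ2 ▸ dvd_mul_right _ _, by omega⟩
  · by_contra hc
    have := rk_mono S (not_lt.1 hc)
    omega
  · by_contra hc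
    have := rk_strict S hv (not_le.1 hc)
    omega

lemma bad_card (S : Finset ℝ) (L : ℕ) (hL : 0 < L) (J δ n : ℕ) (e : ℕ → ℝ) (π : ℕ → ℕ)
    (he : ∀ i j, i < j → j < n → e i < e j) (I : Finset ℕ)
    (hI : ∀ i ∈ I, i < π i ∧ π i ≤ i + J ∧ i + J < n)
    (f : Polynomial ℝ) (hf : f.natDegree ≤ δ)
    (hS : ∀ i, i < n → f.eval (e i) ∈ S) :
    (I.filter (fun i => ¬ cell S L (f.eval (e (π i))) = cell S L (f.eval (e i)))).card
      ≤ (S.card / L) * (δ * (J + 1)) := by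
  classical
  let Z : ℝ → Finset ℕ := fun ρ => I.filter (fun i => e i ≤ ρ ∧ ρ ≤ e (π i))
  have hZ : ∀ ρ, (Z ρ).card ≤ J + 1 := by
    intro ρ
    rcases (Z ρ).eq_empty_or_nonempty with h | h
    · rw [h]; simp
    · let i0 := (Z ρ).min' h
      have hi0 : i0 ∈ Z ρ := Finset.min'_mem _ _
      have : Z ρ ⊆ Finset.Icc i0 (i0 + J) := by
        intro i hi
        have h1 : i0 ≤ i := Finset.min'_le _ _ hi
        simp only [Z, Finset.mem_filter] at hi hi0
        have a1 := hI i hi.1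
        have a2 := hI i0 hi0.1
        rw [Finset.mem_Icc]
        refine ⟨h1, ?_⟩
        by_contra hc
        have : e (π i0) < e i := he _ _ (by omega) (by omega)
        linarith [hi.2.1, hi0.2.2]
      have := Finset.card_le_card this
      simp at this
      omega
  have hsub : (I.filter (fun i => ¬ cell S L (f.eval (e (π i))) = cell S L (f.eval (e i)))) ⊆
      (thr S L).biUnion (fun θ => (f - C θ).roots.toFinset.biUnion Z) := by
    intro i hi
    simp only [Finset.mem_filter] at hi
    obtain ⟨hiI, hne⟩ := hi
    have a1 := hI i hiI
    have hlt : e i < e (π i) := he _ _ a1.1 (by omega)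
    have key : ∃ θ ∈ thr S L, f - C θ ≠ 0 ∧ ∃ ρ ∈ Set.Icc (e i) (e (π i)), f.eval ρ = θ := by
      have hc : ContinuousOn (fun x => f.eval x) (Set.Icc (e i) (e (π i))) :=
        f.continuous.continuousOn
      rcases Nat.lt_or_gt_of_ne hne with h | h
      · obtain ⟨θ, hθ, h1, h2⟩ := thr_sep S L hL (hS i (by omega)) h
        refine ⟨θ, hθ, ?_, ?_⟩
        · intro h0
          have : (f - C θ).eval (e (π i)) = 0 := by rw [h0]; simp
          simp at this; linarith
        · exact intermediate_value_Icc' hlt.le hc ⟨h1.le, h2⟩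
      · obtain ⟨θ, hθ, h1, h2⟩ := thr_sep S L hL (hS (π i) (by omega)) h
        refine ⟨θ, hθ, ?_, ?_⟩
        · intro h0
          have : (f - C θ).eval (e i) = 0 := by rw [h0]; simp
          simp at this; linarith
        · exact intermediate_value_Icc hlt.le hc ⟨h1.le, h2⟩
    obtain ⟨θ, hθ, h0, ρ, hρ, hρ2⟩ := key
    simp only [Finset.mem_biUnion]
    refine ⟨θ, hθ, ρ, ?_, ?_⟩
    · simp [h0, hρ2]
    · simp only [Z, Finset.mem_filter]; exact ⟨hiI, hρ.1, hρ.2⟩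
  refine (Finset.card_le_card hsub).trans ?_
  refine (Finset.card_biUnion_le_card_mul _ _ (δ * (J+1)) ?_).trans ?_
  · intro θ _
    refine (Finset.card_biUnion_le_card_mul _ _ (J+1) (fun ρ _ => hZ ρ)).trans ?_
    apply Nat.mul_le_mul_right
    refine (Multiset.toFinset_card_le _).trans ((card_roots' _).trans ?_)
    refine (natDegree_sub_le _ _).trans ?_
    simp [hf]
  · exact Nat.mul_le_mul_right _ (thr_card S L hL)

lemma fib_card {α β γ : Type*} [DecidableEq β] [DecidableEq γ] (Y : Finset α) (t : Finset β) (M : ℕ) (f : α → β)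
    (g : α → γ) (hf : ∀ y ∈ Y, f y ∈ t) (hinj : ∀ y ∈ Y, ∀ z ∈ Y, f y = f z → g y = g z → y = z)
    (h : ∀ b ∈ t, ∃ W : Finset γ, W.card ≤ M ∧ ∀ y ∈ Y, f y = b → g y ∈ W) :
    Y.card ≤ M * t.card := by
  apply Finset.card_le_mul_card_image_of_maps_to hf
  intro b hb
  obtain ⟨W, hW, h2⟩ := h b hb
  refine le_trans ?_ hW
  apply Finset.card_le_card_of_injOn g
  · intro y hy
    simp only [Finset.coe_filter, Set.mem_ofPred_eq] at hy
    exact h2 y hy.1 hy.2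
  · intro y hy z hz hyz
    simp only [Finset.coe_filter, Set.mem_ofPred_eq] at hy hz
    exact hinj y hy.1 z hz.1 (hy.2.trans hz.2.symm) hyz

lemma comb_count (δ D K n L : ℕ) (hL : 0 < L) (p q : ℝ → ℝ → ℝ)
    (hp : ∀ b, ∃ f : Polynomial ℝ, f.natDegree ≤ δ ∧ ∀ a, p a b = f.eval a)
    (hq : ∀ b, ∃ f : Polynomial ℝ, f.natDegree ≤ δ ∧ ∀ a, q a b = f.eval a)
    (GA : ℝ → Prop) (GAA : ℝ → ℝ → Prop) (GB : ℝ → ℝ → ℝ → Prop)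
    (G : ℝ → ℝ → ℝ → ℝ → Prop)
    (h1 : ∃ W : Finset ℝ, W.card ≤ D ∧ ∀ a, ¬ GA a → a ∈ W)
    (h2 : ∀ a, GA a → ∃ W : Finset ℝ, W.card ≤ D ∧ ∀ a', ¬ GAA a a' → a' ∈ W)
    (h3 : ∀ a a', GAA a a' → ∃ W : Finset ℝ, W.card ≤ D ∧ ∀ b, ¬ GB a a' b → b ∈ W)
    (h4 : ∀ a a' b, GB a a' b → ∃ W : Finset ℝ, W.card ≤ D ∧ ∀ b', ¬ G a a' b b' → b' ∈ W)
    (hK : ∀ s s' t t' : ℝ, ∃ W : Finset (ℝ × ℝ × ℝ × ℝ), W.card ≤ K ∧ ∀ a a' b b',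
      G a a' b b' → p a b = s → p a' b = s' → q a b' = t → q a' b' = t' → (a, a', b, b') ∈ W)
    (A B : Finset ℝ) (hA : A.card = n) (hB : B.card = n) (S T : Finset ℝ)
    (hS : ∀ a ∈ A, ∀ b ∈ B, p a b ∈ S) (hT : ∀ a ∈ A, ∀ b ∈ B, q a b ∈ T) :
    n ^ 3 ≤ K * ((S.card * L) * (T.card * L)) +
      n ^ 2 * ((S.card / L) * (δ * (D + 2)) + (T.card / L) * (δ * (D + 2))) + (4 * D + 1) * n ^ 2 := by
  classical
  let e : ℕ → ℝ := fun i => if h : i < n then A.orderEmbOfFin hA ⟨i, h⟩ else 0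
  have he : ∀ i j, i < j → j < n → e i < e j := by
    intro i j hij hj
    have hi : i < n := hij.trans hj
    simp only [e, hi, hj, dif_pos]
    exact (A.orderEmbOfFin hA).strictMono (by simpa using hij)
  have heA : ∀ i, i < n → e i ∈ A := by
    intro i hi
    simp only [e, hi, dif_pos]
    exact Finset.orderEmbOfFin_mem _ _ _
  have heinj : ∀ i j, i < n → j < n → e i = e j → i = j := by
    intro i j hi hj h
    rcases lt_trichotomy i j with h1 | h1 | h1
    · have := he i j h1 hj; linarith
    · exact h1
    · have := he j i h1 hi; linarith
  let J := D + 1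
  let I : Finset ℕ := (Finset.range (n - J)).filter (fun i => GA (e i))
  have hIlt : ∀ i ∈ I, i + J < n := by
    intro i hi; simp only [I, Finset.mem_filter, Finset.mem_range] at hi; omega
  have hIcard : n ≤ I.card + J + D := by
    obtain ⟨W, hW, hW2⟩ := h1
    have : ((Finset.range (n - J)).filter (fun i => ¬ GA (e i))).card ≤ D := by
      refine le_trans ?_ hW
      apply Finset.card_le_card_of_injOn e
      · intro i hi
        simp only [Finset.coe_filter, Set.mem_ofPred_eq] at hi
        exact hW2 _ hi.2
      · intro i hi j hj
        simp only [Finset.coe_filter, Set.mem_ofPred_eq, Finset.mem_range] at hi hj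
        exact heinj i j (by omega) (by omega)
    have h5 := Finset.card_filter_add_card_filter_not (s := Finset.range (n - J)) (fun i => GA (e i))
    rw [Finset.card_range] at h5
    change I.card + _ = _ at h5
    omega
  have hIn : I.card ≤ n := by
    have := Finset.card_filter_le (Finset.range (n - J)) (fun i => GA (e i))
    rw [Finset.card_range] at this
    change I.card ≤ _ at this
    omega
  have hπ : ∀ i, ∃ j, i ∈ I → i < j ∧ j ≤ i + J ∧ GAA (e i) (e j) := by
    intro i
    by_cases hi : i ∈ I
    · have hi2 := hIlt i hi
      simp only [I, Finset.mem_filter, Finset.mem_range] at hi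
      obtain ⟨W, hW, hW2⟩ := h2 _ hi.2
      by_contra hc
      push Not at hc
      have : (Finset.Ioc i (i + J)).card ≤ W.card := by
        apply Finset.card_le_card_of_injOn e
        · intro j hj
          simp only [Finset.coe_Ioc, Set.mem_Ioc] at hj
          exact hW2 _ ((hc j).2 hj.1 hj.2)
        · intro j hj k hk
          simp only [Finset.coe_Ioc, Set.mem_Ioc] at hj hk
          exact heinj j k (by omega) (by omega)
      simp [J] at this
      omega
    · exact ⟨0, fun h => absurd h hi⟩
  choose π hπ using hπ
  have hI3 : ∀ i ∈ I, i < π i ∧ π i ≤ i + J ∧ i + J < n := fun i hi =>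
    ⟨(hπ i hi).1, (hπ i hi).2.1, hIlt i hi⟩
  let Ω : Finset (ℕ × ℝ × ℝ) := I ×ˢ (B ×ˢ B)
  have hΩ : Ω.card = I.card * (n * n) := by simp [Ω, hB]
  let c1 : ℕ × ℝ × ℝ → Prop := fun z =>
    cell S L (p (e (π z.1)) z.2.1) = cell S L (p (e z.1) z.2.1)
  let c2 : ℕ × ℝ × ℝ → Prop := fun z =>
    cell T L (q (e (π z.1)) z.2.2) = cell T L (q (e z.1) z.2.2)
  let c3 : ℕ × ℝ × ℝ → Prop := fun z => GB (e z.1) (e (π z.1)) z.2.1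
  let c4 : ℕ × ℝ × ℝ → Prop := fun z => G (e z.1) (e (π z.1)) z.2.1 z.2.2
  let X := Ω.filter (fun z => c1 z ∧ c2 z ∧ c4 z)
  have hcov : Ω ⊆ X ∪ (Ω.filter (fun z => ¬ c1 z) ∪ (Ω.filter (fun z => ¬ c2 z) ∪
      (Ω.filter (fun z => ¬ c3 z) ∪ Ω.filter (fun z => c3 z ∧ ¬ c4 z)))) := by
    intro z hz
    simp only [X, Finset.mem_union, Finset.mem_filter, hz, true_and]
    tauto
  have hcov2 := Finset.card_le_card hcov
  have hcov3 : Ω.card ≤ X.card + ((Ω.filter (fun z => ¬ c1 z)).card + ((Ω.filter (fun z => ¬ c2 z)).card +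
      ((Ω.filter (fun z => ¬ c3 z)).card + (Ω.filter (fun z => c3 z ∧ ¬ c4 z)).card))) := by
    refine hcov2.trans ?_
    refine (Finset.card_union_le _ _).trans (Nat.add_le_add_left ?_ _)
    refine (Finset.card_union_le _ _).trans (Nat.add_le_add_left ?_ _)
    refine (Finset.card_union_le _ _).trans (Nat.add_le_add_left ?_ _)
    exact (Finset.card_union_le _ _)
  have memΩ : ∀ z, z ∈ Ω ↔ z.1 ∈ I ∧ z.2.1 ∈ B ∧ z.2.2 ∈ B := by
    intro z; simp [Ω]
  have b1 : (Ω.filter (fun z => ¬ c1 z)).card ≤ (S.card / L * (δ * (J + 1))) * (n * n) := by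
    have : n * n = (B ×ˢ B).card := by simp [hB]
    rw [this]
    apply fib_card _ _ _ (fun z => z.2) (fun z => z.1)
    · intro y hy
      simp only [Finset.mem_filter, memΩ] at hy
      simp [hy.1.2.1, hy.1.2.2]
    · intro y _ z _ h h'; exact Prod.ext h' h
    · intro b hb
      obtain ⟨f, hf, hf2⟩ := hp b.1
      simp only [Finset.mem_product] at hb
      refine ⟨_, bad_card S L hL J δ n e π he I hI3 f hf ?_, ?_⟩
      · intro i hi; rw [← hf2]; exact hS _ (heA i hi) _ hb.1
      · intro y hy hyb
        simp only [Finset.mem_filter, memΩ, c1] at hy ⊢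
        rw [← hf2, ← hf2, ← hyb]
        exact ⟨hy.1.1, hy.2⟩
  have b2 : (Ω.filter (fun z => ¬ c2 z)).card ≤ (T.card / L * (δ * (J + 1))) * (n * n) := by
    have : n * n = (B ×ˢ B).card := by simp [hB]
    rw [this]
    apply fib_card _ _ _ (fun z => z.2) (fun z => z.1)
    · intro y hy
      simp only [Finset.mem_filter, memΩ] at hy
      simp [hy.1.2.1, hy.1.2.2]
    · intro y _ z _ h h'; exact Prod.ext h' h
    · intro b hb
      obtain ⟨f, hf, hf2⟩ := hq b.2
      simp only [Finset.mem_product] at hb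
      refine ⟨_, bad_card T L hL J δ n e π he I hI3 f hf ?_, ?_⟩
      · intro i hi; rw [← hf2]; exact hT _ (heA i hi) _ hb.2
      · intro y hy hyb
        simp only [Finset.mem_filter, memΩ, c2] at hy ⊢
        rw [← hf2, ← hf2, ← hyb]
        exact ⟨hy.1.1, hy.2⟩
  have b3 : (Ω.filter (fun z => ¬ c3 z)).card ≤ D * (I.card * n) := by
    have : I.card * n = (I ×ˢ B).card := by simp [hB]
    rw [this]
    apply fib_card _ _ _ (fun z => (z.1, z.2.2)) (fun z => z.2.1)
    · intro y hy
      simp only [Finset.mem_filter, memΩ] at hy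
      simp [hy.1.1, hy.1.2.2]
    · intro y _ z _ h h'
      simp only [Prod.mk.injEq] at h
      exact Prod.ext h.1 (Prod.ext h' h.2)
    · intro b hb
      simp only [Finset.mem_product] at hb
      obtain ⟨W, hW, hW2⟩ := h3 _ _ (hπ b.1 hb.1).2.2
      refine ⟨W, hW, ?_⟩
      intro y hy hyb
      simp only [Finset.mem_filter, memΩ, c3] at hy
      apply hW2
      rw [← hyb]; exact hy.2
  have b4 : (Ω.filter (fun z => c3 z ∧ ¬ c4 z)).card ≤ D * (I.card * n) := by
    have : I.card * n = (I ×ˢ B).card := by simp [hB]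
    rw [this]
    apply fib_card _ _ _ (fun z => (z.1, z.2.1)) (fun z => z.2.2)
    · intro y hy
      simp only [Finset.mem_filter, memΩ] at hy
      simp [hy.1.1, hy.1.2.1]
    · intro y _ z _ h h'
      simp only [Prod.mk.injEq] at h
      exact Prod.ext h.1 (Prod.ext h.2 h')
    · intro b hb
      simp only [Finset.mem_product] at hb
      by_cases hG : GB (e b.1) (e (π b.1)) b.2
      · obtain ⟨W, hW, hW2⟩ := h4 _ _ _ hG
        refine ⟨W, hW, ?_⟩
        intro y hy hyb
        simp only [Finset.mem_filter, memΩ, c4] at hy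
        apply hW2
        rw [← hyb]; exact hy.2.2
      · refine ⟨∅, by simp, ?_⟩
        intro y hy hyb
        simp only [Finset.mem_filter, memΩ, c3] at hy
        rw [← hyb] at hG
        exact absurd hy.2.1 hG
  have b5 : X.card ≤ K * ((S.card * L) * (T.card * L)) := by
    have : X.card ≤ K * (pairsS S L ×ˢ pairsS T L).card := by
      apply fib_card _ _ _ (fun z : ℕ × ℝ × ℝ => ((p (e z.1) z.2.1, p (e (π z.1)) z.2.1),
          (q (e z.1) z.2.2, q (e (π z.1)) z.2.2)))
        (fun z => (e z.1, e (π z.1), z.2.1, z.2.2))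
      · intro y hy
        simp only [X, Finset.mem_filter, memΩ] at hy
        obtain ⟨⟨hy1, hy2, hy3⟩, hc1, hc2, hc4⟩ := hy
        have a1 := hI3 _ hy1
        simp only [Finset.mem_product, pairsS, Finset.mem_filter]
        exact ⟨⟨⟨hS _ (heA _ (by omega)) _ hy2, hS _ (heA _ (by omega)) _ hy2⟩, hc1⟩,
          ⟨⟨hT _ (heA _ (by omega)) _ hy3, hT _ (heA _ (by omega)) _ hy3⟩, hc2⟩⟩
      · intro y hy z hz _ h
        simp only [X, Finset.mem_filter, memΩ] at hy hz
        have a1 := hI3 _ hy.1.1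
        have a2 := hI3 _ hz.1.1
        simp only [Prod.mk.injEq] at h
        exact Prod.ext (heinj _ _ (by omega) (by omega) h.1) (Prod.ext h.2.2.1 h.2.2.2)
      · intro b _
        obtain ⟨W, hW, hW2⟩ := hK b.1.1 b.1.2 b.2.1 b.2.2
        refine ⟨W, hW, ?_⟩
        intro y hy hyb
        simp only [X, Finset.mem_filter, memΩ] at hy
        apply hW2 _ _ _ _ hy.2.2.2 <;> rw [← hyb]
    refine this.trans ?_
    rw [Finset.card_product]
    exact Nat.mul_le_mul_left _ (Nat.mul_le_mul (pairsS_card S L hL) (pairsS_card T L hL))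
  have hJ : J + 1 = D + 2 := rfl
  have hJ2 : J = D + 1 := rfl
  rw [hJ] at b1 b2
  have b34 : D * (I.card * n) ≤ D * (n * n) :=
    Nat.mul_le_mul_left _ (Nat.mul_le_mul_right _ hIn)
  have hfin : n * (n * n) ≤ (I.card + J + D) * (n * n) := Nat.mul_le_mul_right _ hIcard
  rw [hJ2] at hfin
  rw [hΩ] at hcov3
  nlinarith

set_option maxHeartbeats 1000000 in
lemma comb_main (δ D K : ℕ) : ∃ c : ℝ, 0 < c ∧ ∀ (p q : ℝ → ℝ → ℝ)
    (_ : ∀ b, ∃ f : Polynomial ℝ, f.natDegree ≤ δ ∧ ∀ a, p a b = f.eval a)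
    (_ : ∀ b, ∃ f : Polynomial ℝ, f.natDegree ≤ δ ∧ ∀ a, q a b = f.eval a)
    (GA : ℝ → Prop) (GAA : ℝ → ℝ → Prop) (GB : ℝ → ℝ → ℝ → Prop)
    (G : ℝ → ℝ → ℝ → ℝ → Prop)
    (_ : ∃ W : Finset ℝ, W.card ≤ D ∧ ∀ a, ¬ GA a → a ∈ W)
    (_ : ∀ a, GA a → ∃ W : Finset ℝ, W.card ≤ D ∧ ∀ a', ¬ GAA a a' → a' ∈ W)
    (_ : ∀ a a', GAA a a' → ∃ W : Finset ℝ, W.card ≤ D ∧ ∀ b, ¬ GB a a' b → b ∈ W)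
    (_ : ∀ a a' b, GB a a' b → ∃ W : Finset ℝ, W.card ≤ D ∧ ∀ b', ¬ G a a' b b' → b' ∈ W)
    (_ : ∀ s s' t t' : ℝ, ∃ W : Finset (ℝ × ℝ × ℝ × ℝ), W.card ≤ K ∧ ∀ a a' b b',
      G a a' b b' → p a b = s → p a' b = s' → q a b' = t → q a' b' = t' → (a, a', b, b') ∈ W)
    (n : ℕ) (A B : Finset ℝ) (_ : A.card = n) (_ : B.card = n),
    c * (n : ℝ) ^ ((5 : ℝ) / 4) ≤
            max
              (((A ×ˢ B).image fun ab => p ab.1 ab.2).card : ℝ)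
              (((A ×ˢ B).image fun ab => q ab.1 ab.2).card : ℝ) := by
  obtain ⟨E, hE⟩ : ∃ E : ℕ, E = δ * (D + 2) := ⟨_, rfl⟩
  obtain ⟨N, hN⟩ : ∃ N : ℕ, N = 4 * (4 * D + 1) := ⟨_, rfl⟩
  obtain ⟨c, hc⟩ : ∃ c : ℝ, c = 1 / (16 * ((K : ℝ) + 1) * (E + 1) * (N + 1) ^ 2) := ⟨_, rfl⟩
  have hK0 : (0 : ℝ) ≤ K := by positivity
  have hE0 : (0 : ℝ) ≤ E := by positivity
  have hN0 : (0 : ℝ) ≤ N := by positivity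
  have hc0 : 0 < c := by rw [hc]; positivity
  have hc1 : c * (16 * ((K : ℝ) + 1) * (E + 1) * (N + 1) ^ 2) = 1 := by
    rw [hc]; field_simp
  have hcK : c * (16 * ((K : ℝ) + 1)) ≤ 1 := by
    refine le_trans ?_ hc1.le
    apply mul_le_mul_of_nonneg_left _ hc0.le
    rw [mul_assoc (16 * ((K : ℝ) + 1))]
    apply le_mul_of_one_le_right (by positivity)
    nlinarith [mul_nonneg hE0 hN0, mul_nonneg hN0 hN0, mul_nonneg hE0 (mul_nonneg hN0 hN0)]
  have hcE : c * (16 * ((E : ℝ) + 1)) ≤ 1 := by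
    refine le_trans ?_ hc1.le
    apply mul_le_mul_of_nonneg_left _ hc0.le
    rw [show 16 * ((K : ℝ) + 1) * (E + 1) * (N + 1) ^ 2 = 16 * ((E : ℝ) + 1) * ((K + 1) * (N + 1) ^ 2) by ring]
    apply le_mul_of_one_le_right (by positivity)
    nlinarith [mul_nonneg hK0 hN0, mul_nonneg hN0 hN0, mul_nonneg hK0 (mul_nonneg hN0 hN0)]
  have hcN : c * ((N : ℝ) + 1) ^ 2 ≤ 1 := by
    refine le_trans ?_ hc1.le
    apply mul_le_mul_of_nonneg_left _ hc0.le
    apply le_mul_of_one_le_left (by positivity)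
    nlinarith [mul_nonneg hK0 hE0]
  refine ⟨c, hc0, ?_⟩
  intro p q hp hq GA GAA GB G h1 h2 h3 h4 hK n A B hA hB
  set S := (A ×ˢ B).image fun ab => p ab.1 ab.2 with hS
  set T := (A ×ˢ B).image fun ab => q ab.1 ab.2 with hT
  rcases Nat.eq_zero_or_pos n with hn | hn
  · rw [hn]; simp
  by_contra hcon
  rw [not_le, max_lt_iff] at hcon
  have hn1 : (1 : ℝ) ≤ n := by exact_mod_cast hn
  have hne : (A ×ˢ B).Nonempty := by
    rw [← Finset.card_pos, Finset.card_product, hA, hB]; positivity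
  have hS1 : (1 : ℝ) ≤ S.card := by
    have : 0 < S.card := Finset.card_pos.2 (hne.image _)
    exact_mod_cast this
  obtain ⟨x, hx⟩ : ∃ x : ℝ, x = (n : ℝ) ^ ((1 : ℝ) / 4) := ⟨_, rfl⟩
  have hx1 : 1 ≤ x := by rw [hx]; exact Real.one_le_rpow hn1 (by norm_num)
  have hx4 : x ^ 4 = n := by
    rw [hx, ← Real.rpow_natCast, ← Real.rpow_mul (by positivity)]; norm_num
  have hx5 : (n : ℝ) ^ ((5 : ℝ) / 4) = x ^ 5 := by
    rw [hx, ← Real.rpow_natCast, ← Real.rpow_mul (by positivity)]; norm_num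
  rw [hx5] at hcon
  have hNn : (N : ℝ) < n := by
    by_contra hle
    rw [not_lt] at hle
    have e1 : x ^ 5 ≤ x ^ 8 := pow_le_pow_right₀ hx1 (by norm_num)
    have e2 : x ^ 8 = (n : ℝ) ^ 2 := by rw [← hx4]; ring
    have e3 : (n : ℝ) ^ 2 ≤ ((N : ℝ) + 1) ^ 2 := by gcongr; linarith
    have e4 : c * x ^ 5 ≤ c * ((N : ℝ) + 1) ^ 2 := by
      apply mul_le_mul_of_nonneg_left _ hc0.le; linarith
    linarith [hcon.1]
  obtain ⟨L, hLdef⟩ : ∃ L : ℕ, L = ⌈x⌉₊ := ⟨_, rfl⟩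
  have hxL : x ≤ L := by rw [hLdef]; exact Nat.le_ceil x
  have hLx : (L : ℝ) ≤ 2 * x := by
    have := Nat.ceil_lt_add_one (a := x) (by linarith)
    rw [hLdef]; linarith
  have hL : 0 < L := by
    have : (0 : ℝ) < L := by linarith
    exact_mod_cast this
  have main := comb_count δ D K n L hL p q hp hq GA GAA GB G h1 h2 h3 h4 hK A B hA hB S T
    (fun a ha b hb => Finset.mem_image.2 ⟨(a, b), Finset.mem_product.2 ⟨ha, hb⟩, rfl⟩)
    (fun a ha b hb => Finset.mem_image.2 ⟨(a, b), Finset.mem_product.2 ⟨ha, hb⟩, rfl⟩)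
  rw [← hE] at main
  have main' : (n : ℝ) ^ 3 ≤ K * ((S.card * L) * (T.card * L)) +
      n ^ 2 * (((S.card / L : ℕ) : ℝ) * E + ((T.card / L : ℕ) : ℝ) * E) + (4 * D + 1) * n ^ 2 := by
    exact_mod_cast main
  have hL0 : (0 : ℝ) < L := by exact_mod_cast hL
  have gen : ∀ U : Finset ℝ, (U.card : ℝ) < c * x ^ 5 →
      (U.card : ℝ) * L ≤ 2 * c * x ^ 6 ∧ ((U.card / L : ℕ) : ℝ) ≤ c * n := by
    intro U hU
    constructor
    · calc (U.card : ℝ) * L ≤ (c * x ^ 5) * (2 * x) := by gcongr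
        _ = _ := by ring
    · refine Nat.cast_div_le.trans ?_
      rw [div_le_iff₀ hL0, ← hx4]
      calc (U.card : ℝ) ≤ c * x ^ 5 := hU.le
        _ = c * x ^ 4 * x := by ring
        _ ≤ _ := by gcongr
  obtain ⟨s1, s2⟩ := gen S hcon.1
  obtain ⟨t1, t2⟩ := gen T hcon.2
  have f1 : (K : ℝ) * ((S.card * L) * (T.card * L)) ≤ n ^ 3 / 4 := by
    calc (K : ℝ) * ((S.card * L) * (T.card * L)) ≤ K * ((2 * c * x ^ 6) * (2 * c * x ^ 6)) := by gcongr
      _ = (4 * K * c * c) * n ^ 3 := by rw [← hx4]; ring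
      _ ≤ (1 / 4) * n ^ 3 := by
        gcongr
        have : c ≤ 1 := by nlinarith
        nlinarith [mul_nonneg hK0 hc0.le, mul_nonneg (mul_nonneg hK0 hc0.le) (sub_nonneg.2 this)]
      _ = _ := by ring
  have f2 : (n : ℝ) ^ 2 * (((S.card / L : ℕ) : ℝ) * E + ((T.card / L : ℕ) : ℝ) * E) ≤ n ^ 3 / 4 := by
    calc (n : ℝ) ^ 2 * (((S.card / L : ℕ) : ℝ) * E + ((T.card / L : ℕ) : ℝ) * E)
        ≤ n ^ 2 * ((c * n) * E + (c * n) * E) := by gcongr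
      _ = (2 * c * E) * n ^ 3 := by ring
      _ ≤ (1 / 4) * n ^ 3 := by
        gcongr
        nlinarith
      _ = _ := by ring
  have f3 : (4 * (D : ℝ) + 1) * n ^ 2 ≤ n ^ 3 / 4 := by
    have : (N : ℝ) = 4 * (4 * D + 1) := by rw [hN]; push_cast; ring
    calc (4 * (D : ℝ) + 1) * n ^ 2 ≤ (n / 4) * n ^ 2 := by gcongr; linarith
      _ = _ := by ring
  have : (0 : ℝ) < n ^ 3 := by positivity
  linarith

lemma mv_aeval_totalDegree_le {σ τ : Type*} [Fintype σ] (F : σ → MvPolynomial τ ℝ) (δ : ℕ)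
    (hF : ∀ i, (F i).totalDegree ≤ δ) (G : MvPolynomial σ ℝ) :
    (MvPolynomial.aeval F G).totalDegree ≤ G.totalDegree * δ := by
  rw [MvPolynomial.aeval_def, MvPolynomial.eval₂_eq']
  apply MvPolynomial.totalDegree_finsetSum_le
  intro d hd
  refine (MvPolynomial.totalDegree_mul _ _).trans ?_
  rw [MvPolynomial.algebraMap_eq, MvPolynomial.totalDegree_C, zero_add]
  refine (MvPolynomial.totalDegree_finsetProd _ _).trans ?_
  have h1 : ∑ i, d i ≤ G.totalDegree := by
    have := MvPolynomial.le_totalDegree hd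
    rwa [Finsupp.sum_fintype _ _ (by simp)] at this
  calc ∑ i, (F i ^ d i).totalDegree ≤ ∑ i, d i * δ := by
        apply Finset.sum_le_sum
        intro i _
        exact (MvPolynomial.totalDegree_pow _ _).trans (Nat.mul_le_mul_left _ (hF i))
    _ = (∑ i, d i) * δ := by rw [Finset.sum_mul]
    _ ≤ _ := Nat.mul_le_mul_right _ h1

lemma slice_poly {σ : Type*} [DecidableEq σ] (Ψ : MvPolynomial σ ℝ) (i : σ) (x : σ → ℝ) :
    ∃ f : Polynomial ℝ, f.natDegree ≤ Ψ.totalDegree ∧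
      ∀ t, f.eval t = MvPolynomial.eval (Function.update x i t) Ψ := by
  refine ⟨MvPolynomial.aeval (fun j => if j = i then (X : Polynomial ℝ) else C (x j)) Ψ, ?_, ?_⟩
  · have := MvPolynomial.aeval_natDegree_le (n := 1) Ψ le_rfl
      (fun j => if j = i then (X : Polynomial ℝ) else C (x j)) (by
        intro j; split_ifs <;> simp)
    simpa using this
  · intro t
    have := MvPolynomial.eval₂_comp_left (Polynomial.evalRingHom t) (algebraMap ℝ ℝ[X])
      (fun j => if j = i then (X : Polynomial ℝ) else C (x j)) Ψ
    rw [MvPolynomial.aeval_def]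
    change (Polynomial.evalRingHom t) _ = _
    rw [this, MvPolynomial.eval]
    have h1 : (Polynomial.evalRingHom t).comp (algebraMap ℝ ℝ[X]) = RingHom.id ℝ := by
      ext; simp
    have h2 : (⇑(Polynomial.evalRingHom t) ∘ fun j => if j = i then (X : Polynomial ℝ) else C (x j))
        = Function.update x i t := by
      ext j
      by_cases h : j = i
      · subst h; simp
      · simp [h]
    rw [h1, h2]
    rfl

lemma exists_rel (δ N : ℕ) (hN : N = (1 + 4 * δ) ^ 4) (F : Fin 4 → MvPolynomial (Fin 4) ℝ)
    (hF : ∀ i, (F i).totalDegree ≤ δ) (i : Fin 4) :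
    ∃ φ : Fin (N + 1) → MvPolynomial (Fin 4) ℝ, (∃ k, φ k ≠ 0) ∧
      (∀ k, (φ k).totalDegree ≤ 4 * N) ∧
      ∑ k, MvPolynomial.aeval F (φ k) * MvPolynomial.X i ^ (k : ℕ) = 0 := by
  classical
  let M := N * (1 + 4 * δ)
  let mon : (Fin 4 → Fin (N + 1)) → MvPolynomial (Fin 4) ℝ := fun β => ∏ l, F l ^ (β l : ℕ)
  let T1 : ((Fin (N + 1) × (Fin 4 → Fin (N + 1))) → ℝ) →ₗ[ℝ] MvPolynomial (Fin 4) ℝ :=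
    Fintype.linearCombination ℝ (fun kb : Fin (N + 1) × (Fin 4 → Fin (N + 1)) =>
      mon kb.2 * MvPolynomial.X i ^ (kb.1 : ℕ))
  let T2 : MvPolynomial (Fin 4) ℝ →ₗ[ℝ] ((Fin 4 → Fin (M + 1)) → ℝ) :=
    LinearMap.pi (fun γ => MvPolynomial.lcoeff ℝ (Finsupp.equivFunOnFinite.symm (fun l => (γ l : ℕ))))
  have hker : LinearMap.ker (T2 ∘ₗ T1) ≠ ⊥ := by
    apply LinearMap.ker_ne_bot_of_finrank_lt
    simp only [Module.finrank_fintype_fun_eq_card, Fintype.card_prod, Fintype.card_fin,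
      Fintype.card_fun]
    calc (M + 1) ^ 4 ≤ ((N + 1) * (1 + 4 * δ)) ^ 4 := by
          apply Nat.pow_le_pow_left
          simp only [M]
          nlinarith
      _ = (N + 1) ^ 4 * N := by rw [mul_pow, hN]
      _ < (N + 1) ^ 4 * (N + 1) := by
          apply Nat.mul_lt_mul_of_pos_left (by omega) (by positivity)
      _ = _ := by ring
  obtain ⟨c, hc, hc0⟩ := (Submodule.ne_bot_iff _).1 hker
  rw [LinearMap.mem_ker, LinearMap.comp_apply] at hc
  have hdeg : (T1 c).totalDegree ≤ M := by
    simp only [T1, Fintype.linearCombination_apply]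
    apply MvPolynomial.totalDegree_finsetSum_le
    intro kb _
    refine (MvPolynomial.totalDegree_smul_le _ _).trans ?_
    refine (MvPolynomial.totalDegree_mul _ _).trans ?_
    have h1 : (mon kb.2).totalDegree ≤ 4 * (N * δ) := by
      refine (MvPolynomial.totalDegree_finsetProd _ _).trans ?_
      calc ∑ l, (F l ^ (kb.2 l : ℕ)).totalDegree ≤ ∑ l : Fin 4, N * δ := by
            apply Finset.sum_le_sum
            intro l _
            exact (MvPolynomial.totalDegree_pow _ _).trans
              (Nat.mul_le_mul (Nat.lt_succ_iff.1 (kb.2 l).2) (hF l))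
        _ = _ := by simp
    have h2 : ((MvPolynomial.X i : MvPolynomial (Fin 4) ℝ) ^ (kb.1 : ℕ)).totalDegree ≤ N := by
      rw [MvPolynomial.totalDegree_X_pow]
      exact Nat.lt_succ_iff.1 kb.1.2
    simp only [M]
    nlinarith
  have hT1 : T1 c = 0 := by
    ext d
    rw [MvPolynomial.coeff_zero]
    by_cases hd : ∀ l, d l ≤ M
    · have := congrFun hc (fun l => ⟨d l, by have := hd l; omega⟩)
      simp only [T2, LinearMap.pi_apply, MvPolynomial.lcoeff_apply, Pi.zero_apply] at this
      convert this using 2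
      ext l; simp
    · push Not at hd
      obtain ⟨l, hl⟩ := hd
      apply MvPolynomial.coeff_eq_zero_of_totalDegree_lt
      refine lt_of_le_of_lt hdeg (lt_of_lt_of_le hl ?_)
      apply Finset.single_le_sum (f := fun l => d l) (by simp)
      simp only [Finsupp.mem_support_iff]; omega
  let zmon : (Fin 4 → Fin (N + 1)) → MvPolynomial (Fin 4) ℝ := fun β =>
    MvPolynomial.monomial (Finsupp.equivFunOnFinite.symm (fun l => (β l : ℕ))) 1
  refine ⟨fun k => ∑ β, c (k, β) • zmon β, ?_, ?_, ?_⟩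
  · obtain ⟨⟨k, β⟩, hkb⟩ := Function.ne_iff.1 hc0
    refine ⟨k, ?_⟩
    intro h0
    have := congrArg (MvPolynomial.coeff (Finsupp.equivFunOnFinite.symm (fun l => (β l : ℕ)))) h0
    rw [MvPolynomial.coeff_sum, Finset.sum_eq_single β] at this
    · simp [zmon, MvPolynomial.coeff_smul] at this
      exact hkb this
    · intro β' _ hne
      simp only [zmon, MvPolynomial.coeff_smul, MvPolynomial.coeff_monomial]
      rw [if_neg, smul_zero]
      intro h
      apply hne
      have h2 := Finsupp.equivFunOnFinite.symm.injective h
      ext l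
      exact congrFun h2 l
    · simp
  · intro k
    apply MvPolynomial.totalDegree_finsetSum_le
    intro β _
    refine (MvPolynomial.totalDegree_smul_le _ _).trans ?_
    refine (MvPolynomial.totalDegree_monomial_le _ _).trans ?_
    rw [Finsupp.sum_fintype _ _ (by simp)]
    calc _ ≤ ∑ l : Fin 4, N := by
          apply Finset.sum_le_sum
          intro l _
          simpa using Nat.lt_succ_iff.1 (β l).2
      _ = _ := by simp
  · rw [← hT1]
    simp only [T1, Fintype.linearCombination_apply, Fintype.sum_prod_type]
    apply Finset.sum_congr rfl
    intro k _
    rw [map_sum, Finset.sum_mul]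
    apply Finset.sum_congr rfl
    intro β _
    rw [map_smul, smul_mul_assoc]
    congr 2
    simp only [zmon, mon]
    rw [MvPolynomial.aeval_monomial, Finsupp.prod_fintype _ _ (by simp)]
    simp

lemma fibre_bound (δ : ℕ) : ∃ D K : ℕ, ∀ F : Fin 4 → MvPolynomial (Fin 4) ℝ,
    (∀ i, (F i).totalDegree ≤ δ) → AlgebraicIndependent ℝ F →
    ∃ Ψ : MvPolynomial (Fin 4) ℝ, Ψ ≠ 0 ∧ Ψ.totalDegree ≤ D ∧
      ∀ v : Fin 4 → ℝ, ∃ W : Finset (Fin 4 → ℝ), W.card ≤ K ∧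
        ∀ x, MvPolynomial.eval x Ψ ≠ 0 → (∀ i, MvPolynomial.eval x (F i) = v i) → x ∈ W := by
  classical
  obtain ⟨N, hN⟩ : ∃ N, N = (1 + 4 * δ) ^ 4 := ⟨_, rfl⟩
  refine ⟨4 * (4 * N * δ), N ^ 4, ?_⟩
  intro F hF hind
  choose φ hφ0 hφd hφ using fun i => exists_rel δ N hN F hF i
  choose k hk using hφ0
  refine ⟨∏ i, MvPolynomial.aeval F (φ i (k i)), ?_, ?_, ?_⟩
  · rw [Finset.prod_ne_zero_iff]
    intro i _ h0
    exact hk i (hind.eq_zero_of_aeval_eq_zero _ h0)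
  · refine (MvPolynomial.totalDegree_finsetProd _ _).trans ?_
    calc _ ≤ ∑ i : Fin 4, 4 * N * δ := by
          apply Finset.sum_le_sum
          intro i _
          exact (mv_aeval_totalDegree_le F δ hF _).trans (Nat.mul_le_mul_right _ (hφd i _))
      _ = _ := by simp
  · intro v
    let h : Fin 4 → Polynomial ℝ := fun i =>
      ∑ l : Fin (N + 1), C (MvPolynomial.eval v (φ i l)) * X ^ (l : ℕ)
    have hev : ∀ x, (∀ i, MvPolynomial.eval x (F i) = v i) → ∀ G : MvPolynomial (Fin 4) ℝ,
        MvPolynomial.eval x (MvPolynomial.aeval F G) = MvPolynomial.eval v G := by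
      intro x hx G
      have : v = fun i => MvPolynomial.eval x (F i) := by ext i; exact (hx i).symm
      rw [this]
      induction G using MvPolynomial.induction_on with
      | C a => simp [MvPolynomial.algebraMap_eq]
      | add p q hp hq => simp only [map_add, hp, hq]
      | mul_X p k hp => simp only [map_mul, hp, MvPolynomial.aeval_X, MvPolynomial.eval_X]
    refine ⟨Fintype.piFinset (fun i => (h i).roots.toFinset), ?_, ?_⟩
    · rw [Fintype.card_piFinset]
      calc _ ≤ ∏ i : Fin 4, N := by
            apply Finset.prod_le_prod' 
            intro i _
            refine (Multiset.toFinset_card_le _).trans ((card_roots' _).trans ?_)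
            apply natDegree_sum_le_of_forall_le
            intro l _
            exact (natDegree_C_mul_X_pow_le _ _).trans (Nat.lt_succ_iff.1 l.2)
        _ = _ := by simp
    · intro x hx hv
      rw [map_prod, Finset.prod_ne_zero_iff] at hx
      rw [Fintype.mem_piFinset]
      intro i
      have h1 := hx i (Finset.mem_univ _)
      rw [hev x hv] at h1
      rw [Multiset.mem_toFinset, mem_roots']
      constructor
      · intro h0
        apply h1
        have := congrArg (fun p => coeff p (k i : ℕ)) h0
        simp only [h, finsetSum_coeff, coeff_C_mul, coeff_X_pow, coeff_zero] at this
        rw [Finset.sum_eq_single (k i)] at this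
        · simpa using this
        · intro b _ hb
          rw [if_neg, mul_zero]
          intro hh; exact hb (Fin.ext hh.symm)
        · simp
      · have := congrArg (MvPolynomial.eval x) (hφ i)
        simp only [map_sum, map_mul, hev x hv, map_pow, MvPolynomial.eval_X, map_zero] at this
        simp only [IsRoot, h, eval_finsetSum, eval_mul, eval_C, eval_pow, eval_X]
        exact this

lemma mv_chain {σ τ : Type*} [Fintype σ] (F : σ → MvPolynomial τ ℝ) (j : τ) (G : MvPolynomial σ ℝ) :
    MvPolynomial.pderiv j (MvPolynomial.aeval F G) =
      ∑ i, MvPolynomial.aeval F (MvPolynomial.pderiv i G) * MvPolynomial.pderiv j (F i) := by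
  classical
  induction G using MvPolynomial.induction_on with
  | C a => simp [MvPolynomial.algebraMap_eq]
  | add p q hp hq => simp only [map_add, hp, hq, add_mul, Finset.sum_add_distrib]
  | mul_X p k hp =>
    simp only [map_mul, Derivation.leibniz, MvPolynomial.aeval_X, hp, MvPolynomial.pderiv_X, smul_eq_mul,
      map_add, add_mul, Finset.sum_add_distrib]
    congr 1
    · rw [Finset.sum_eq_single k]
      · simp
      · intro b _ hb; simp [hb.symm]
      · simp
    · rw [Finset.mul_sum]
      apply Finset.sum_congr rfl
      intro i _
      ring

lemma mv_exists_pderiv {σ : Type*} (G : MvPolynomial σ ℝ) (hG : ∀ c, G ≠ MvPolynomial.C c) :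
    ∃ i, MvPolynomial.pderiv i G ≠ 0 ∧ (MvPolynomial.pderiv i G).totalDegree < G.totalDegree := by
  classical
  have h1 : ∃ m ∈ G.support, m ≠ 0 := by
    by_contra hc
    push Not at hc
    apply hG (G.coeff 0)
    ext m
    rw [MvPolynomial.coeff_C]
    split_ifs with h
    · rw [h]
    · by_contra h2
      exact h (hc m (MvPolynomial.mem_support_iff.2 h2)).symm
  obtain ⟨m, hm, hm0⟩ := h1
  obtain ⟨i, hi⟩ := Finsupp.ne_iff.1 hm0
  simp only [Finsupp.coe_zero, Pi.zero_apply] at hi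
  have hmi : m - Finsupp.single i 1 + Finsupp.single i 1 = m := by
    ext k
    simp only [Finsupp.coe_add, Finsupp.coe_tsub, Pi.add_apply, Pi.sub_apply, Finsupp.single_apply]
    split_ifs with h
    · subst h; omega
    · simp
  have hne : MvPolynomial.pderiv i G ≠ 0 := by
    intro h0
    have := MvPolynomial.coeff_pderiv (i := i) G (m - Finsupp.single i 1)
    rw [h0, hmi] at this
    simp only [MvPolynomial.coeff_zero] at this
    have h3 := MvPolynomial.mem_support_iff.1 hm
    have h4 : (((m - Finsupp.single i 1 : σ →₀ ℕ) i : ℕ) : ℝ) + 1 ≠ 0 := by positivity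
    simp_all
  refine ⟨i, hne, ?_⟩
  obtain ⟨k, hk, hk2⟩ : ∃ k ∈ (MvPolynomial.pderiv i G).support,
      (MvPolynomial.pderiv i G).totalDegree = k.sum fun _ e => e := by
    have hs : (MvPolynomial.pderiv i G).support.Nonempty := by
      rwa [Finset.nonempty_iff_ne_empty, Ne, MvPolynomial.support_eq_empty]
    exact Finset.exists_mem_eq_sup _ hs _
  rw [hk2]
  have h5 : k + Finsupp.single i 1 ∈ G.support := by
    rw [MvPolynomial.mem_support_iff] at hk ⊢
    rw [MvPolynomial.coeff_pderiv] at hk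
    intro h; rw [h] at hk; simp at hk
  have h6 := MvPolynomial.le_totalDegree h5
  rw [Finsupp.sum_add_index' (by simp) (by simp), Finsupp.sum_single_index (by simp)] at h6
  omega

lemma dep_deriv {σ τ : Type*} [Fintype σ] (F : σ → MvPolynomial τ ℝ) (hF : ¬ AlgebraicIndependent ℝ F) :
    ∃ g : σ → MvPolynomial τ ℝ, (∃ i, g i ≠ 0) ∧
      ∀ j, ∑ i, g i * MvPolynomial.pderiv j (F i) = 0 := by
  classical
  rw [algebraicIndependent_iff] at hF
  push Not at hF
  have hex : ∃ n, ∃ G : MvPolynomial σ ℝ, MvPolynomial.aeval F G = 0 ∧ G ≠ 0 ∧ G.totalDegree = n := by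
    obtain ⟨G, h1, h2⟩ := hF
    exact ⟨_, G, h1, h2, rfl⟩
  obtain ⟨G, h1, h2, h3⟩ := Nat.find_spec hex
  obtain ⟨i, hi, hi2⟩ := mv_exists_pderiv G (by
    rintro c rfl
    simp [MvPolynomial.algebraMap_eq] at h1
    simp [h1] at h2)
  refine ⟨fun i => MvPolynomial.aeval F (MvPolynomial.pderiv i G), ⟨i, ?_⟩, ?_⟩
  · intro h
    have := Nat.find_min' hex ⟨_, h, hi, rfl⟩
    omega
  · intro j
    rw [← mv_chain, h1]; simp

lemma pderiv_rename_pair (i k : Fin 4) (j : Fin 4) (P : MvPolynomial (Fin 2) ℝ) :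
    MvPolynomial.pderiv j (MvPolynomial.rename ![i, k] P) =
      (if i = j then MvPolynomial.rename ![i, k] (MvPolynomial.pderiv 0 P) else 0) +
      (if k = j then MvPolynomial.rename ![i, k] (MvPolynomial.pderiv 1 P) else 0) := by
  have h : ∀ R : MvPolynomial (Fin 2) ℝ, MvPolynomial.rename ![i, k] R =
    MvPolynomial.aeval (fun l => (MvPolynomial.X (![i, k] l) : MvPolynomial (Fin 4) ℝ)) R := by
    intro R
    exact DFunLike.congr_fun (MvPolynomial.algHom_ext (by intro l; simp)) R
  rw [h, mv_chain, Fin.sum_univ_two, ← h, ← h]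
  simp only [Matrix.cons_val_zero, Matrix.cons_val_one, MvPolynomial.pderiv_X, Pi.single_apply]
  split_ifs <;> simp_all

/-- the four-variable system -/
def sysF (P Q : MvPolynomial (Fin 2) ℝ) : Fin 4 → MvPolynomial (Fin 4) ℝ :=
  ![MvPolynomial.rename ![0, 2] P, MvPolynomial.rename ![1, 2] P,
    MvPolynomial.rename ![0, 3] Q, MvPolynomial.rename ![1, 3] Q]

def ev (P : MvPolynomial (Fin 2) ℝ) (x y : ℝ) : ℝ := MvPolynomial.eval ![x, y] P

lemma eval_ren (P : MvPolynomial (Fin 2) ℝ) (i k : Fin 4) (x : Fin 4 → ℝ) :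
    MvPolynomial.eval x (MvPolynomial.rename ![i, k] P) = ev P (x i) (x k) := by
  rw [MvPolynomial.eval_rename, ev]
  congr 2
  ext l
  fin_cases l <;> simp

lemma ren_ne (P : MvPolynomial (Fin 2) ℝ) (hP : P ≠ 0) (i k : Fin 4) (h : i ≠ k) :
    MvPolynomial.rename ![i, k] P ≠ 0 := by
  intro h0
  apply hP
  apply MvPolynomial.rename_injective ![i, k] _ (by rw [h0]; simp)
  intro a b hab
  fin_cases a <;> fin_cases b <;> simp_all

lemma dep_identity (P Q : MvPolynomial (Fin 2) ℝ)
    (hP0 : MvPolynomial.pderiv 0 P ≠ 0) (hP1 : MvPolynomial.pderiv 1 P ≠ 0)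
    (hQ0 : MvPolynomial.pderiv 0 Q ≠ 0) (hQ1 : MvPolynomial.pderiv 1 Q ≠ 0)
    (hF : ¬ AlgebraicIndependent ℝ (sysF P Q)) (a a' b b' : ℝ) :
    ev (MvPolynomial.pderiv 0 P) a b * ev (MvPolynomial.pderiv 1 P) a' b *
      ev (MvPolynomial.pderiv 0 Q) a' b' * ev (MvPolynomial.pderiv 1 Q) a b' =
    ev (MvPolynomial.pderiv 0 P) a' b * ev (MvPolynomial.pderiv 1 P) a b *
      ev (MvPolynomial.pderiv 0 Q) a b' * ev (MvPolynomial.pderiv 1 Q) a' b' := by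
  obtain ⟨g, ⟨i, hi⟩, hg⟩ := dep_deriv _ hF
  have e0 := hg 0
  have e1 := hg 1
  have e2 := hg 2
  have e3 := hg 3
  simp only [sysF, Fin.sum_univ_four, Matrix.cons_val, pderiv_rename_pair] at e0 e1 e2 e3
  simp at e0 e1 e2 e3
  have n1 := ren_ne _ hP0 0 2 (by decide)
  have n2 := ren_ne _ hP1 0 2 (by decide)
  have n3 := ren_ne _ hP0 1 2 (by decide)
  have n4 := ren_ne _ hP1 1 2 (by decide)
  have n5 := ren_ne _ hQ0 0 3 (by decide)
  have n6 := ren_ne _ hQ1 0 3 (by decide)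
  have n7 := ren_ne _ hQ0 1 3 (by decide)
  have n8 := ren_ne _ hQ1 1 3 (by decide)
  have key : (MvPolynomial.rename ![0, 2] (MvPolynomial.pderiv 0 P) : MvPolynomial (Fin 4) ℝ) *
      MvPolynomial.rename ![1, 2] (MvPolynomial.pderiv 1 P) *
      MvPolynomial.rename ![1, 3] (MvPolynomial.pderiv 0 Q) *
      MvPolynomial.rename ![0, 3] (MvPolynomial.pderiv 1 Q) =
      MvPolynomial.rename ![1, 2] (MvPolynomial.pderiv 0 P) *
      MvPolynomial.rename ![0, 2] (MvPolynomial.pderiv 1 P) *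
      MvPolynomial.rename ![0, 3] (MvPolynomial.pderiv 0 Q) *
      MvPolynomial.rename ![1, 3] (MvPolynomial.pderiv 1 Q) := by
    generalize (MvPolynomial.rename ![0, 2] (MvPolynomial.pderiv 0 P) : MvPolynomial (Fin 4) ℝ) = p1 at *
    generalize (MvPolynomial.rename ![0, 2] (MvPolynomial.pderiv 1 P) : MvPolynomial (Fin 4) ℝ) = p2 at *
    generalize (MvPolynomial.rename ![1, 2] (MvPolynomial.pderiv 0 P) : MvPolynomial (Fin 4) ℝ) = p3 at *
    generalize (MvPolynomial.rename ![1, 2] (MvPolynomial.pderiv 1 P) : MvPolynomial (Fin 4) ℝ) = p4 at *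
    generalize (MvPolynomial.rename ![0, 3] (MvPolynomial.pderiv 0 Q) : MvPolynomial (Fin 4) ℝ) = q1 at *
    generalize (MvPolynomial.rename ![0, 3] (MvPolynomial.pderiv 1 Q) : MvPolynomial (Fin 4) ℝ) = q2 at *
    generalize (MvPolynomial.rename ![1, 3] (MvPolynomial.pderiv 0 Q) : MvPolynomial (Fin 4) ℝ) = q3 at *
    generalize (MvPolynomial.rename ![1, 3] (MvPolynomial.pderiv 1 Q) : MvPolynomial (Fin 4) ℝ) = q4 at *
    have h0 : g 0 ≠ 0 := by
      intro h0
      simp [h0, n4] at e2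
      simp [h0, n5] at e0
      simp [e2, n7] at e1
      fin_cases i <;> simp_all
    have h1 : g 1 ≠ 0 := by
      intro h
      simp [h, h0, n2] at e2
    have h2 : g 2 ≠ 0 := by
      intro h
      simp [h, h0, n1] at e0
    have h3 : g 3 ≠ 0 := by
      intro h
      simp [h, h1, n3] at e1
    apply mul_left_cancel₀ (mul_ne_zero (mul_ne_zero h0 h1) (mul_ne_zero h2 h3))
    have f0 : g 0 * p1 = - (g 2 * q1) := by linear_combination e0
    have f1 : g 3 * q3 = - (g 1 * p3) := by linear_combination e1
    have f2 : g 1 * p4 = - (g 0 * p2) := by linear_combination e2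
    have f3 : g 2 * q2 = - (g 3 * q4) := by linear_combination e3
    calc _ = (g 0 * p1) * (g 1 * p4) * (g 3 * q3) * (g 2 * q2) := by ring
      _ = _ := by rw [f0, f1, f2, f3]; ring
  have := congrArg (MvPolynomial.eval ![a, a', b, b']) key
  simp only [map_mul, eval_ren] at this
  simpa using this

lemma indep_main (δ : ℕ) : ∃ c : ℝ, 0 < c ∧ ∀ P Q : MvPolynomial (Fin 2) ℝ,
    P.totalDegree ≤ δ → Q.totalDegree ≤ δ → AlgebraicIndependent ℝ (sysF P Q) →
    ∀ (n : ℕ) (A B : Finset ℝ), A.card = n → B.card = n →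
    c * (n : ℝ) ^ ((5 : ℝ) / 4) ≤
            max
              (((A ×ˢ B).image fun ab => ev P ab.1 ab.2).card : ℝ)
              (((A ×ˢ B).image fun ab => ev Q ab.1 ab.2).card : ℝ) := by
  classical
  obtain ⟨D, K, hDK⟩ := fibre_bound δ
  obtain ⟨c, hc, hmain⟩ := comb_main δ D K
  refine ⟨c, hc, ?_⟩
  intro P Q hP hQ hind n A B hA hB
  have hdeg : ∀ i, (sysF P Q i).totalDegree ≤ δ := by
    intro i
    fin_cases i
    · exact (MvPolynomial.totalDegree_rename_le _ _).trans hP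
    · exact (MvPolynomial.totalDegree_rename_le _ _).trans hP
    · exact (MvPolynomial.totalDegree_rename_le _ _).trans hQ
    · exact (MvPolynomial.totalDegree_rename_le _ _).trans hQ
  obtain ⟨Ψ, hΨ0, hΨd, hW⟩ := hDK _ hdeg hind
  have hslice : ∀ R : MvPolynomial (Fin 2) ℝ, R.totalDegree ≤ δ →
      ∀ b, ∃ f : Polynomial ℝ, f.natDegree ≤ δ ∧ ∀ a, ev R a b = f.eval a := by
    intro R hR b
    obtain ⟨f, hf, hf2⟩ := slice_poly R 0 ![0, b]
    refine ⟨f, hf.trans hR, ?_⟩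
    intro a
    rw [hf2, ev]
    congr 2
    ext l; fin_cases l <;> simp
  let ψ : ℝ → ℝ → ℝ → ℝ → ℝ := fun a a' b b' => MvPolynomial.eval ![a, a', b, b'] Ψ
  have hroots : ∀ (i : Fin 4) (x : Fin 4 → ℝ), (MvPolynomial.eval x Ψ ≠ 0) →
      ∃ W : Finset ℝ, W.card ≤ D ∧ ∀ t, MvPolynomial.eval (Function.update x i t) Ψ = 0 → t ∈ W := by
    intro i x hx
    obtain ⟨f, hf, hf2⟩ := slice_poly Ψ i x
    refine ⟨f.roots.toFinset, (Multiset.toFinset_card_le _).trans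
      ((card_roots' _).trans (hf.trans hΨd)), ?_⟩
    intro t ht
    rw [Multiset.mem_toFinset, mem_roots']
    refine ⟨?_, by rw [IsRoot, hf2, ht]⟩
    intro h0
    apply hx
    have := hf2 (x i)
    rw [h0, Function.update_eq_self] at this
    simpa using this.symm
  have u0 : ∀ a a' b b' t : ℝ, Function.update ![a, a', b, b'] 0 t = ![t, a', b, b'] := by
    intros; ext l; fin_cases l <;> simp
  have u1 : ∀ a a' b b' t : ℝ, Function.update ![a, a', b, b'] 1 t = ![a, t, b, b'] := by
    intros; ext l; fin_cases l <;> simp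
  have u2 : ∀ a a' b b' t : ℝ, Function.update ![a, a', b, b'] 2 t = ![a, a', t, b'] := by
    intros; ext l; fin_cases l <;> simp
  have u3 : ∀ a a' b b' t : ℝ, Function.update ![a, a', b, b'] 3 t = ![a, a', b, t] := by
    intros; ext l; fin_cases l <;> simp
  have hne : ∃ a a' b b', ψ a a' b b' ≠ 0 := by
    by_contra hcon
    push Not at hcon
    apply hΨ0
    apply MvPolynomial.funext
    intro x
    have := hcon (x 0) (x 1) (x 2) (x 3)
    simp only [ψ] at this
    rw [map_zero, ← this]
    congr 2
    ext l; fin_cases l <;> simp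
  refine hmain (ev P) (ev Q) (hslice P hP) (hslice Q hQ)
    (fun a => ∃ a' b b', ψ a a' b b' ≠ 0) (fun a a' => ∃ b b', ψ a a' b b' ≠ 0)
    (fun a a' b => ∃ b', ψ a a' b b' ≠ 0) (fun a a' b b' => ψ a a' b b' ≠ 0)
    ?_ ?_ ?_ ?_ ?_ n A B hA hB
  · obtain ⟨a, a', b, b', h⟩ := hne
    obtain ⟨W, h1, h2⟩ := hroots 0 _ h
    refine ⟨W, h1, fun t ht => h2 t ?_⟩
    rw [u0]
    push Not at ht
    exact ht _ _ _
  · rintro a ⟨a', b, b', h⟩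
    obtain ⟨W, h1, h2⟩ := hroots 1 _ h
    refine ⟨W, h1, fun t ht => h2 t ?_⟩
    rw [u1]
    push Not at ht
    exact ht _ _
  · rintro a a' ⟨b, b', h⟩
    obtain ⟨W, h1, h2⟩ := hroots 2 _ h
    refine ⟨W, h1, fun t ht => h2 t ?_⟩
    rw [u2]
    push Not at ht
    exact ht _
  · rintro a a' b ⟨b', h⟩
    obtain ⟨W, h1, h2⟩ := hroots 3 _ h
    refine ⟨W, h1, fun t ht => h2 t ?_⟩
    rw [u3]
    push Not at ht
    exact ht
  · intro s s' t t'
    obtain ⟨W, h1, h2⟩ := hW ![s, s', t, t']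
    refine ⟨W.image (fun x => (x 0, x 1, x 2, x 3)), Finset.card_image_le.trans h1, ?_⟩
    intro a a' b b' hG e1 e2 e3 e4
    rw [Finset.mem_image]
    refine ⟨![a, a', b, b'], h2 _ hG ?_, by simp⟩
    intro i
    fin_cases i
    · simpa [sysF, eval_ren] using e1
    · simpa [sysF, eval_ren] using e2
    · simpa [sysF, eval_ren] using e3
    · simpa [sysF, eval_ren] using e4

/-- swap the two variables -/
def sw (P : MvPolynomial (Fin 2) ℝ) : MvPolynomial (Fin 2) ℝ := MvPolynomial.rename ![1, 0] P

lemma ev_sw (P : MvPolynomial (Fin 2) ℝ) (x y : ℝ) : ev (sw P) x y = ev P y x := by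
  rw [ev, sw, MvPolynomial.eval_rename, ev]
  congr 2
  ext l; fin_cases l <;> simp

lemma sw_inj : Function.Injective (![1, 0] : Fin 2 → Fin 2) := by
  intro a b h
  fin_cases a <;> fin_cases b <;> simp_all

lemma pderiv_sw0 (P : MvPolynomial (Fin 2) ℝ) :
    MvPolynomial.pderiv 0 (sw P) = sw (MvPolynomial.pderiv 1 P) := by
  have := MvPolynomial.pderiv_rename sw_inj 1 P
  simpa [sw] using this

lemma pderiv_sw1 (P : MvPolynomial (Fin 2) ℝ) :
    MvPolynomial.pderiv 1 (sw P) = sw (MvPolynomial.pderiv 0 P) := by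
  have := MvPolynomial.pderiv_rename sw_inj 0 P
  simpa [sw] using this

lemma sw_ne (P : MvPolynomial (Fin 2) ℝ) (h : P ≠ 0) : sw P ≠ 0 := by
  intro h0
  exact h (MvPolynomial.rename_injective _ sw_inj (by rw [← sw, h0]; simp))

lemma pderiv_ne (P : MvPolynomial (Fin 2) ℝ) (i : Fin 2) (h : 1 ≤ P.degreeOf i) :
    MvPolynomial.pderiv i P ≠ 0 := by
  intro h0
  have : P.degreeOf i ≤ 0 := by
    rw [MvPolynomial.degreeOf_le_iff]
    intro m hm
    by_contra hi
    have hmi : m - Finsupp.single i 1 + Finsupp.single i 1 = m := by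
      ext k
      simp only [Finsupp.coe_add, Finsupp.coe_tsub, Pi.add_apply, Pi.sub_apply, Finsupp.single_apply]
      split_ifs with h
      · subst h; omega
      · simp
    have := MvPolynomial.coeff_pderiv (i := i) P (m - Finsupp.single i 1)
    rw [h0, hmi] at this
    simp only [MvPolynomial.coeff_zero] at this
    have h3 := MvPolynomial.mem_support_iff.1 hm
    have h4 : (((m - Finsupp.single i 1 : Fin 2 →₀ ℕ) i : ℕ) : ℝ) + 1 ≠ 0 := by positivity
    exact (mul_ne_zero h3 h4) this.symm
  omega

/-- reduction to the structural statement -/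
lemma reduction (δ : ℕ) : ∃ c : ℝ, 0 < c ∧ ∀ P Q : MvPolynomial (Fin 2) ℝ,
    P.totalDegree ≤ δ → Q.totalDegree ≤ δ →
    MvPolynomial.pderiv 0 P ≠ 0 → MvPolynomial.pderiv 1 P ≠ 0 →
    MvPolynomial.pderiv 0 Q ≠ 0 → MvPolynomial.pderiv 1 Q ≠ 0 →
    (∀ (n : ℕ) (A B : Finset ℝ), A.card = n → B.card = n →
    c * (n : ℝ) ^ ((5 : ℝ) / 4) ≤
            max
              (((A ×ˢ B).image fun ab => ev P ab.1 ab.2).card : ℝ)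
              (((A ×ˢ B).image fun ab => ev Q ab.1 ab.2).card : ℝ)) ∨
    ((∀ a a' b b', ev (MvPolynomial.pderiv 0 P) a b * ev (MvPolynomial.pderiv 1 P) a' b *
      ev (MvPolynomial.pderiv 0 Q) a' b' * ev (MvPolynomial.pderiv 1 Q) a b' =
    ev (MvPolynomial.pderiv 0 P) a' b * ev (MvPolynomial.pderiv 1 P) a b *
      ev (MvPolynomial.pderiv 0 Q) a b' * ev (MvPolynomial.pderiv 1 Q) a' b') ∧
     (∀ a a' b b', ev (MvPolynomial.pderiv 1 P) b a * ev (MvPolynomial.pderiv 0 P) b a' *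
      ev (MvPolynomial.pderiv 1 Q) b' a' * ev (MvPolynomial.pderiv 0 Q) b' a =
    ev (MvPolynomial.pderiv 1 P) b a' * ev (MvPolynomial.pderiv 0 P) b a *
      ev (MvPolynomial.pderiv 1 Q) b' a * ev (MvPolynomial.pderiv 0 Q) b' a')) := by
  classical
  obtain ⟨c, hc, h⟩ := indep_main δ
  refine ⟨c, hc, ?_⟩
  intro P Q hP hQ hP0 hP1 hQ0 hQ1
  by_cases h1 : AlgebraicIndependent ℝ (sysF P Q)
  · left; exact h P Q hP hQ h1
  by_cases h2 : AlgebraicIndependent ℝ (sysF (sw P) (sw Q))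
  · left
    intro n A B hA hB
    have := h (sw P) (sw Q) ((MvPolynomial.totalDegree_rename_le _ _).trans hP)
      ((MvPolynomial.totalDegree_rename_le _ _).trans hQ) h2 n B A hB hA
    have himg : ∀ R : MvPolynomial (Fin 2) ℝ, ((B ×ˢ A).image fun ab => ev (sw R) ab.1 ab.2) =
        ((A ×ˢ B).image fun ab => ev R ab.1 ab.2) := by
      intro R
      ext z
      simp only [Finset.mem_image, Finset.mem_product, Prod.exists, ev_sw]
      constructor
      · rintro ⟨a, b, ⟨h1, h2⟩, h3⟩; exact ⟨b, a, ⟨h2, h1⟩, h3⟩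
      · rintro ⟨a, b, ⟨h1, h2⟩, h3⟩; exact ⟨b, a, ⟨h2, h1⟩, h3⟩
    rwa [himg, himg] at this
  right
  refine ⟨dep_identity P Q hP0 hP1 hQ0 hQ1 h1, ?_⟩
  intro a a' b b'
  have := dep_identity (sw P) (sw Q) (by rw [pderiv_sw0]; exact sw_ne _ hP1)
    (by rw [pderiv_sw1]; exact sw_ne _ hP0) (by rw [pderiv_sw0]; exact sw_ne _ hQ1)
    (by rw [pderiv_sw1]; exact sw_ne _ hQ0) h2 a a' b b'
  simpa only [pderiv_sw0, pderiv_sw1, ev_sw] using this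

/-- derivative in the first (inner) variable of a bivariate polynomial -/
def dx (P : ℝ[X][X]) : ℝ[X][X] := PolynomialModule.equivPolynomialSelf (derivative'.mapCoeffs P)

lemma coeff_dx (P : ℝ[X][X]) (i : ℕ) : (dx P).coeff i = derivative (P.coeff i) := rfl

lemma dx_add (P Q : ℝ[X][X]) : dx (P + Q) = dx P + dx Q := by
  ext1 i; simp [coeff_dx]

lemma dx_sub (P Q : ℝ[X][X]) : dx (P - Q) = dx P - dx Q := by
  ext1 i; simp [coeff_dx]

lemma dx_mul (P Q : ℝ[X][X]) : dx (P * Q) = P * dx Q + Q * dx P := by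
  unfold dx
  rw [Derivation.leibniz, map_add, map_smul, map_smul, smul_eq_mul, smul_eq_mul]

lemma dx_C (p : ℝ[X]) : dx (C p) = C (derivative p) := by
  ext1 i; rw [coeff_dx, coeff_C, coeff_C]; split_ifs <;> simp

lemma dx_map (q : ℝ[X]) : dx (q.map C) = 0 := by
  ext1 i; simp [coeff_dx]

lemma dx_natDegree (P : ℝ[X][X]) : (dx P).natDegree ≤ P.natDegree := by
  rw [natDegree_le_iff_coeff_eq_zero]
  intro i hi
  rw [coeff_dx, coeff_eq_zero_of_natDegree_lt hi, derivative_zero]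

lemma dx_aeval (W : ℝ[X][X]) (f : ℝ[X]) : dx (aeval W f) = aeval W (derivative f) * dx W := by
  induction f using Polynomial.induction_on with
  | C a => 
    simp only [aeval_C, derivative_C, map_zero, zero_mul]
    change dx (C (C a)) = 0
    rw [dx_C]; simp
  | add p q hp hq => simp only [map_add, dx_add, hp, hq, add_mul]
  | monomial n a h =>
    rw [pow_succ, ← mul_assoc, map_mul, dx_mul, h]
    simp only [derivative_mul, map_add, map_mul, derivative_X, aeval_X, map_one, mul_one]
    ring

lemma dy_aeval (W : ℝ[X][X]) (f : ℝ[X]) :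
    derivative (aeval W f) = aeval W (derivative f) * derivative W := by
  induction f using Polynomial.induction_on with
  | C a => 
    simp only [aeval_C, derivative_C, map_zero, zero_mul]
    change derivative (C (C a)) = 0
    simp
  | add p q hp hq => simp only [map_add, hp, hq, add_mul]
  | monomial n a h =>
    rw [pow_succ, ← mul_assoc, map_mul, derivative_mul, h]
    simp only [derivative_mul, map_add, map_mul, derivative_X, aeval_X, map_one, mul_one]
    ring

lemma evalEval_aeval (W : ℝ[X][X]) (f : ℝ[X]) (x y : ℝ) :
    (aeval W f).evalEval x y = f.eval (W.evalEval x y) := by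
  induction f using Polynomial.induction_on with
  | C a => 
    simp only [aeval_C, eval_C]
    change (C (C a)).evalEval x y = a
    simp
  | add p q hp hq => simp only [map_add, evalEval_add, hp, hq, eval_add]
  | monomial n a h =>
    rw [pow_succ, ← mul_assoc, map_mul, evalEval_mul, h, eval_mul]
    simp

lemma evalEval_ext {P Q : ℝ[X][X]} (h : ∀ x y, P.evalEval x y = Q.evalEval x y) : P = Q := by
  ext1 i
  apply Polynomial.funext
  intro x
  have : P.map (evalRingHom x) = Q.map (evalRingHom x) := by
    apply Polynomial.funext
    intro y
    rw [map_evalRingHom_eval, map_evalRingHom_eval, h]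
  have := congrArg (fun p => p.coeff i) this
  simpa using this

lemma coeff_swap (P : ℝ[X][X]) (i j : ℕ) :
    ((Bivariate.swap P).coeff i).coeff j = (P.coeff j).coeff i := by
  induction P using Polynomial.induction_on' with
  | add p q hp hq => simp [hp, hq]
  | monomial n p =>
    induction p using Polynomial.induction_on' with
    | add p q hp hq => 
      rw [map_add, map_add, coeff_add, coeff_add, coeff_add, coeff_add, hp, hq]
    | monomial m a =>
      rw [Bivariate.swap_monomial_monomial]
      simp only [coeff_monomial]
      split_ifs <;> simp_all [coeff_monomial]

lemma dx_swap (P : ℝ[X][X]) : dx (Bivariate.swap P) = Bivariate.swap (derivative P) := by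
  ext i j
  rw [coeff_dx, coeff_derivative, coeff_swap, coeff_swap, coeff_derivative]
  have : ((j : ℝ[X]) + 1) = C ((j : ℝ) + 1) := by simp
  rw [this, coeff_mul_C]

lemma dy_swap (P : ℝ[X][X]) : derivative (Bivariate.swap P) = Bivariate.swap (dx P) := by
  have h := dx_swap (Bivariate.swap P)
  rw [Bivariate.swap_swap_apply] at h
  rw [h, Bivariate.swap_swap_apply]

lemma natDegree_coeff_le_swap (P : ℝ[X][X]) (i : ℕ) :
    (P.coeff i).natDegree ≤ (Bivariate.swap P).natDegree := by
  rw [natDegree_le_iff_coeff_eq_zero]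
  intro j hj
  rw [← coeff_swap, coeff_eq_zero_of_natDegree_lt hj, coeff_zero]

lemma exists_antideriv (f : ℝ[X]) : ∃ F : ℝ[X], derivative F = f := by
  induction f using Polynomial.induction_on' with
  | add p q hp hq =>
    obtain ⟨F, hF⟩ := hp
    obtain ⟨G, hG⟩ := hq
    exact ⟨F + G, by rw [derivative_add, hF, hG]⟩
  | monomial n a =>
    refine ⟨monomial (n + 1) (a / (n + 1)), ?_⟩
    rw [derivative_monomial]
    have : ((n : ℝ) + 1) ≠ 0 := by positivity
    simp [this]

lemma natDegree_pos_of_deriv (f : ℝ[X]) (h : derivative f ≠ 0) : 0 < f.natDegree := by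
  by_contra h0
  apply h
  rw [eq_C_of_natDegree_eq_zero (by omega : f.natDegree = 0), derivative_C]

/-- if both partial derivatives vanish, the polynomial is constant -/
lemma const_of_partials {P : ℝ[X][X]} (h1 : dx P = 0) (h2 : derivative P = 0) :
    ∃ a : ℝ, P = C (C a) := by
  have h3 := natDegree_eq_zero_of_derivative_eq_zero h2
  rw [eq_C_of_natDegree_eq_zero h3] at h1 ⊢
  rw [dx_C, C_eq_zero] at h1
  exact ⟨_, by rw [← eq_C_of_natDegree_eq_zero (natDegree_eq_zero_of_derivative_eq_zero h1)]⟩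

/-- kernel of the vector field -/
def Ker (p1 p2 q1 q2 : ℝ[X]) (k : ℝ) (P : ℝ[X][X]) : Prop :=
  C p1 * q1.map C * dx P = C (C k * p2) * q2.map C * derivative P

lemma Ker.swap {p1 p2 q1 q2 : ℝ[X]} {k : ℝ} (hk : k ≠ 0) {P : ℝ[X][X]} (h : Ker p1 p2 q1 q2 k P) :
    Ker q2 q1 p2 p1 k⁻¹ (Bivariate.swap P) := by
  unfold Ker at *
  have := congrArg Bivariate.swap h
  simp only [map_mul, Bivariate.swap_C, Bivariate.swap_map_C, Polynomial.map_mul, Polynomial.map_C] at this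
  rw [dx_swap, dy_swap]
  have hkk : (C (C k⁻¹) * C (C k) : ℝ[X][X]) = 1 := by
    rw [← C_mul, ← C_mul, inv_mul_cancel₀ hk]; simp
  rw [C_mul]
  linear_combination (-C (C k⁻¹)) * this + (-p2.map C * C q2 * Bivariate.swap (derivative P)) * hkk

lemma Ker.sub {p1 p2 q1 q2 : ℝ[X]} {k : ℝ} {P Q : ℝ[X][X]} (h : Ker p1 p2 q1 q2 k P)
    (h' : Ker p1 p2 q1 q2 k Q) : Ker p1 p2 q1 q2 k (P - Q) := by
  unfold Ker at *
  rw [dx_sub, derivative_sub]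
  linear_combination h - h'

lemma Ker.aeval {p1 p2 q1 q2 : ℝ[X]} {k : ℝ} {W : ℝ[X][X]} (h : Ker p1 p2 q1 q2 k W) (f : ℝ[X]) :
    Ker p1 p2 q1 q2 k (aeval W f) := by
  unfold Ker at *
  rw [dx_aeval, dy_aeval]
  linear_combination (Polynomial.aeval W (derivative f)) * h

lemma lead_dy {P : ℝ[X][X]} (h : derivative P ≠ 0) :
    1 ≤ P.natDegree ∧ (derivative P).natDegree = P.natDegree - 1 ∧
      (derivative P).leadingCoeff = C (P.natDegree : ℝ) * P.leadingCoeff := by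
  have h1 : 1 ≤ P.natDegree := by
    by_contra h0
    exact h (derivative_eq_zero.2 (by omega))
  have h2 : (derivative P).natDegree = P.natDegree - 1 := natDegree_derivative P
  refine ⟨h1, h2, ?_⟩
  rw [leadingCoeff, h2, coeff_derivative, Nat.sub_add_cancel h1, leadingCoeff, mul_comm]
  congr 1
  obtain ⟨m, hm⟩ : ∃ m, P.natDegree = m + 1 := ⟨P.natDegree - 1, by omega⟩
  rw [hm]; simp

/-- comparison of leading terms in the outer variable -/
lemma lead_cmp {p1 p2 q1 q2 : ℝ[X]} {k : ℝ} (hk : k ≠ 0) {P : ℝ[X][X]}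
    (hp1 : p1.Monic) (hp2 : p2.Monic) (hq1 : q1.Monic) (hq2 : q2.Monic) (hp : IsCoprime p1 p2)
    (h : Ker p1 p2 q1 q2 k P) (hx : dx P ≠ 0) (hy : derivative P ≠ 0) :
    (q2.natDegree = q1.natDegree + 1 ∧
      p1 * derivative P.leadingCoeff = C (k * P.natDegree) * p2 * P.leadingCoeff) ∨
    (q2.natDegree ≤ q1.natDegree ∧ p1 = 1) := by
  obtain ⟨h1, h2, h3⟩ := lead_dy hy
  have hL := congrArg leadingCoeff h
  have hD := congrArg natDegree h
  have hq1m : (q1.map (C : ℝ →+* ℝ[X])).Monic := hq1.map _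
  have hq2m : (q2.map (C : ℝ →+* ℝ[X])).Monic := hq2.map _
  have hkp : (C (C k * p2) : ℝ[X][X]) ≠ 0 := by
    rw [Ne, C_eq_zero]; exact mul_ne_zero (by simpa using hk) hp2.ne_zero
  have hp1' : (C p1 : ℝ[X][X]) ≠ 0 := by
    rw [Ne, C_eq_zero]; exact hp1.ne_zero
  simp only [leadingCoeff_mul, leadingCoeff_C, hq1m.leadingCoeff, hq2m.leadingCoeff, mul_one, h3] at hL
  rw [natDegree_mul (mul_ne_zero hp1' hq1m.ne_zero) hx, natDegree_mul hp1' hq1m.ne_zero,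
    natDegree_mul (mul_ne_zero hkp hq2m.ne_zero) hy, natDegree_mul hkp hq2m.ne_zero, natDegree_C,
    natDegree_C, h2, natDegree_map_eq_of_injective C_injective,
    natDegree_map_eq_of_injective C_injective] at hD
  have hle := dx_natDegree P
  by_cases hc : (dx P).natDegree = P.natDegree
  · left
    refine ⟨by omega, ?_⟩
    rw [leadingCoeff, hc, coeff_dx] at hL
    rw [leadingCoeff] at hL ⊢
    rw [hL, C_mul]; ring
  · right
    refine ⟨by omega, ?_⟩
    have hc' : derivative (P.coeff P.natDegree) = 0 := by
      rw [← coeff_dx]; exact coeff_eq_zero_of_natDegree_lt (by omega)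
    have hc2 := eq_C_of_natDegree_eq_zero (derivative_eq_zero.1 hc')
    rw [leadingCoeff, leadingCoeff] at hL
    have hne : P.coeff P.natDegree ≠ 0 := by
      intro h0
      have : P = 0 := by rwa [← leadingCoeff_eq_zero]
      rw [this] at hy; simp at hy
    rw [hc2] at hL hne
    set e := (P.coeff P.natDegree).coeff 0
    have he : e ≠ 0 := by simpa using hne
    have hu : p1 ∣ p2 := by
      have hm : k * (P.natDegree : ℝ) * e ≠ 0 :=
        mul_ne_zero (mul_ne_zero hk (by exact_mod_cast (by omega))) he
      refine ⟨(dx P).coeff (dx P).natDegree * C (k * (P.natDegree : ℝ) * e)⁻¹, ?_⟩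
      rw [← mul_assoc, hL]
      have : (C k * C (P.natDegree : ℝ) * C e * C (k * (P.natDegree : ℝ) * e)⁻¹ : ℝ[X]) = 1 := by
        rw [← C_mul, ← C_mul, ← C_mul, mul_inv_cancel₀ hm, C_1]
      linear_combination (-p2) * this
    have : IsUnit p1 := hp.isUnit_of_dvd' dvd_rfl hu
    exact hp1.eq_one_of_isUnit this

/-- additive case -/
lemma additive_case {p2 q1 : ℝ[X]} {k : ℝ} (hk : k ≠ 0) (hp2 : p2 ≠ 0) (hq1 : q1.Monic) {U V : ℝ[X]}
    (hU : derivative U = C k * p2) (hV : derivative V = q1) :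
    ∀ (n : ℕ) (P : ℝ[X][X]), P.natDegree < n → Ker 1 p2 q1 1 k P →
      ∃ f : ℝ[X], P = aeval (C U + V.map C) f := by
  intro n
  induction n with
  | zero => intro P h; omega
  | succ n ih =>
    intro P hn hP
    have hq1m : (q1.map (C : ℝ →+* ℝ[X])).Monic := hq1.map _
    have hkp : (C k * p2 : ℝ[X]) ≠ 0 := mul_ne_zero (by simpa using hk) hp2
    have hkp' : (C (C k * p2) : ℝ[X][X]) ≠ 0 := by rwa [Ne, C_eq_zero]
    by_cases hy : derivative P = 0
    · have hx : dx P = 0 := by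
        unfold Ker at hP
        rw [hy] at hP
        simpa [hq1m.ne_zero] using hP
      obtain ⟨a, ha⟩ := const_of_partials hx hy
      exact ⟨C a, by rw [ha, aeval_C]; rfl⟩
    unfold Ker at hP
    simp only [map_one, one_mul, Polynomial.map_one, mul_one] at hP
    have hdvd : q1.map C ∣ derivative P := by
      rw [← modByMonic_eq_zero_iff_dvd hq1m]
      have h1 : q1.map C ∣ C (C k * p2) * derivative P := ⟨_, hP.symm⟩
      rw [← modByMonic_eq_zero_iff_dvd hq1m, ← smul_eq_C_mul, smul_modByMonic, smul_eq_C_mul] at h1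
      exact (mul_eq_zero.1 h1).resolve_left hkp'
    obtain ⟨P1, hP1⟩ := hdvd
    have hxP : dx P = C (C k * p2) * P1 := by
      apply mul_left_cancel₀ hq1m.ne_zero
      rw [hP, hP1]; ring
    have hcomm : dx (derivative P) = derivative (dx P) := by
      ext1 i
      rw [coeff_dx, coeff_derivative, coeff_derivative, coeff_dx]
      simp
    have hK1 : Ker 1 p2 q1 1 k P1 := by
      unfold Ker
      simp only [map_one, one_mul, Polynomial.map_one, mul_one]
      rw [hxP, hP1, dx_mul, dx_map, derivative_mul, derivative_C] at hcomm
      linear_combination hcomm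
    have hdeg : P1.natDegree < n := by
      obtain ⟨h1, h2, -⟩ := lead_dy hy
      have hP10 : P1 ≠ 0 := by rintro rfl; rw [mul_zero] at hP1; exact hy hP1
      rw [hP1, natDegree_mul hq1m.ne_zero hP10] at h2
      omega
    obtain ⟨f1, hf1⟩ := ih P1 hdeg hK1
    obtain ⟨F, hF⟩ := exists_antideriv f1
    have e1 : dx (P - aeval (C U + V.map C) F) = 0 := by
      rw [dx_sub, dx_aeval, dx_add, dx_C, dx_map, hxP, hU, hF, hf1]; ring
    have e2 : derivative (P - aeval (C U + V.map C) F) = 0 := by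
      rw [derivative_sub, dy_aeval, derivative_add, derivative_C, derivative_map, hP1, hV, hF, hf1]; ring
    obtain ⟨a, ha⟩ := const_of_partials e1 e2
    refine ⟨F + C a, ?_⟩
    rw [map_add, aeval_C]
    change P = _ + C (C a)
    rw [← ha]; ring

lemma lead_deg {p r c : ℝ[X]} (hp : p.Monic) (hr : r.Monic) (hc : c.Monic)
    (hd : p.natDegree = r.natDegree + 1) {s : ℝ} (h : p * derivative c = C s * r * c) :
    s = c.natDegree := by
  by_cases h0 : c.natDegree = 0
  · rw [derivative_eq_zero.2 h0, mul_zero] at h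
    have := h.symm
    simp only [mul_eq_zero, hr.ne_zero, hc.ne_zero, or_false, C_eq_zero] at this
    rw [this, h0]; simp
  · have h1 := congrArg (fun t => t.coeff (r.natDegree + c.natDegree)) h
    have e1 : r.natDegree + c.natDegree = p.natDegree + (c.natDegree - 1) := by omega
    rw [mul_assoc, coeff_C_mul, coeff_mul_add_eq_of_natDegree_le le_rfl le_rfl, e1,
      coeff_mul_add_eq_of_natDegree_le le_rfl (natDegree_derivative_le c), coeff_derivative,
      Nat.sub_add_cancel (by omega)] at h1
    rw [hp.coeff_natDegree, hr.coeff_natDegree, hc.coeff_natDegree] at h1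
    obtain ⟨m, hm⟩ : ∃ m, c.natDegree = m + 1 := ⟨c.natDegree - 1, by omega⟩
    rw [hm] at h1 ⊢
    simp at h1
    simp [h1]

lemma monic_ode_unique {F G : ℝ[X]} (hF : F.Monic) (hG : G.Monic)
    (h : derivative F * G = F * derivative G) : F = G := by
  by_contra hne
  set H := F - G with hH
  have hH0 : H ≠ 0 := sub_ne_zero.2 hne
  have h2 : derivative F * H = F * derivative H := by
    rw [hH, derivative_sub]; linear_combination -h
  have hdlt : H.natDegree ≠ F.natDegree := by
    intro hd
    have hGF : G.natDegree = F.natDegree := by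
      have hz : F.natDegree = 0 ∨ F.natDegree ≠ 0 := by omega
      by_cases g0 : derivative G = 0
      · rw [g0, mul_zero, mul_eq_zero] at h
        rw [derivative_eq_zero.1 g0, derivative_eq_zero.1 (h.resolve_right hG.ne_zero)]
      · have f0 : derivative F ≠ 0 := by
          intro f0; rw [f0, zero_mul] at h
          exact (mul_ne_zero hF.ne_zero g0) h.symm
        have := congrArg leadingCoeff h
        rw [leadingCoeff_mul, leadingCoeff_mul, hG.leadingCoeff, hF.leadingCoeff, mul_one, one_mul,
          leadingCoeff, leadingCoeff, natDegree_derivative, natDegree_derivative,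
          coeff_derivative, coeff_derivative] at this
        have a1 := natDegree_pos_of_deriv _ f0
        have a2 := natDegree_pos_of_deriv _ g0
        rw [Nat.sub_add_cancel a1, Nat.sub_add_cancel a2, hF.coeff_natDegree, hG.coeff_natDegree,
          ← Nat.cast_succ, ← Nat.cast_succ] at this
        simp only [Nat.succ_eq_add_one, Nat.sub_add_cancel a1, Nat.sub_add_cancel a2, one_mul] at this
        exact_mod_cast this.symm
    have : H.coeff F.natDegree = 0 := by
      rw [hH, coeff_sub, hF.coeff_natDegree, ← hGF, hG.coeff_natDegree, sub_self]
    rw [← hd, coeff_natDegree, leadingCoeff_eq_zero] at this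
    exact hH0 this
  by_cases g0 : derivative H = 0
  · rw [g0, mul_zero, mul_eq_zero] at h2
    rw [derivative_eq_zero.1 g0, derivative_eq_zero.1 (h2.resolve_right hH0)] at hdlt
    exact hdlt rfl
  · have f0 : derivative F ≠ 0 := by
      intro f0; rw [f0, zero_mul] at h2
      exact (mul_ne_zero hF.ne_zero g0) h2.symm
    have := congrArg leadingCoeff h2
    rw [leadingCoeff_mul, leadingCoeff_mul, hF.leadingCoeff, one_mul,
      leadingCoeff, leadingCoeff, leadingCoeff, natDegree_derivative, natDegree_derivative,
      coeff_derivative, coeff_derivative] at this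
    have a1 := natDegree_pos_of_deriv _ f0
    have a2 := natDegree_pos_of_deriv _ g0
    rw [Nat.sub_add_cancel a1, Nat.sub_add_cancel a2, hF.coeff_natDegree,
      ← Nat.cast_succ, ← Nat.cast_succ] at this
    simp only [Nat.succ_eq_add_one, Nat.sub_add_cancel a1, Nat.sub_add_cancel a2, one_mul,
      coeff_natDegree] at this
    rw [mul_comm] at this
    have := mul_left_cancel₀ (leadingCoeff_ne_zero.2 hH0) this
    exact hdlt (by exact_mod_cast this.symm)

lemma ode_pow {p r f g : ℝ[X]} (hp : p ≠ 0) (hf : f.Monic) (hg : g.Monic) {a b : ℕ}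
    (h1 : p * derivative f = C (a : ℝ) * r * f) (h2 : p * derivative g = C (b : ℝ) * r * g) :
    f ^ b = g ^ a := by
  apply monic_ode_unique (hf.pow _) (hg.pow _)
  apply mul_left_cancel₀ hp
  have key : ∀ (f : ℝ[X]) (a n : ℕ), p * derivative f = C (a : ℝ) * r * f →
      p * derivative (f ^ n) = C ((n : ℝ) * a) * r * f ^ n := by
    intro f a n h
    rw [derivative_pow]
    cases n with
    | zero => simp
    | succ n => 
      rw [C_mul, Nat.add_sub_cancel]
      linear_combination (C ((n + 1 : ℕ) : ℝ) * f ^ n) * h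
  have k1 := key f a b h1
  have k2 := key g b a h2
  rw [mul_comm (b : ℝ)] at k1
  linear_combination (g ^ a) * k1 - (f ^ b) * k2

/-- product-type elements of the kernel -/
def Eig (p1 p2 q1 q2 : ℝ[X]) (k : ℝ) (c d : ℝ[X]) : Prop :=
  c.Monic ∧ d.Monic ∧ p1 * derivative c = C (d.natDegree : ℝ) * (C k * p2) * c ∧
    q2 * derivative d = C (d.natDegree : ℝ) * q1 * d

lemma Eig.ker {p1 p2 q1 q2 : ℝ[X]} {k : ℝ} {c d : ℝ[X]} (h : Eig p1 p2 q1 q2 k c d) :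
    Ker p1 p2 q1 q2 k (C c * d.map C) := by
  obtain ⟨hc, hd, h1, h2⟩ := h
  unfold Ker
  rw [dx_mul, dx_C, dx_map, derivative_mul, derivative_C, derivative_map]
  have e1 := congrArg (C : ℝ[X] → ℝ[X][X]) h1
  have e2 := congrArg (fun t => Polynomial.map (C : ℝ →+* ℝ[X]) t) h2
  simp only [C_mul, Polynomial.map_mul, Polynomial.map_C] at e1 e2 ⊢
  linear_combination (q1.map C * d.map C) * e1 - (C (C k) * C p2 * C c) * e2

lemma eig_of_ker {p1 p2 q1 q2 : ℝ[X]} {k : ℝ} (hk : k ≠ 0) {P : ℝ[X][X]}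
    (hp1 : p1.Monic) (hp2 : p2.Monic) (hq1 : q1.Monic) (hq2 : q2.Monic)
    (hp : IsCoprime p1 p2) (hq : IsCoprime q1 q2)
    (hdp : p1.natDegree = p2.natDegree + 1) (hdq : q2.natDegree = q1.natDegree + 1)
    (h : Ker p1 p2 q1 q2 k P) (hx : dx P ≠ 0) (hy : derivative P ≠ 0) :
    ∃ (c d : ℝ[X]) (l : ℝ), Eig p1 p2 q1 q2 k c d ∧ d.natDegree = P.natDegree ∧
      P.leadingCoeff = C l * c := by
  have hP0 : P ≠ 0 := by rintro rfl; simp at hy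
  set S := Bivariate.swap P with hS
  have hS0 : S ≠ 0 := by
    rw [hS]; simpa using hP0
  have hxS : dx S ≠ 0 := by
    rw [hS, dx_swap]; simpa only [ne_eq, EmbeddingLike.map_eq_zero_iff] using hy
  have hyS : derivative S ≠ 0 := by
    rw [hS, dy_swap]; simpa only [ne_eq, EmbeddingLike.map_eq_zero_iff] using hx
  have hKS := h.swap hk
  have hA := lead_cmp hk hp1 hp2 hq1 hq2 hp h hx hy
  have hB := lead_cmp (inv_ne_zero hk) hq2 hq1 hp2 hp1 hq.symm hKS hxS hyS
  have hA' := (hA.resolve_right (by omega)).2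
  have hB' := (hB.resolve_right (by omega)).2
  rw [← hS] at hB'
  have norm : ∀ (p r c : ℝ[X]) (s : ℝ), c ≠ 0 → p * derivative c = C s * r * c →
      ∃ (l : ℝ) (c' : ℝ[X]), c'.Monic ∧ c = C l * c' ∧ c'.natDegree = c.natDegree ∧
        p * derivative c' = C s * r * c' := by
    intro p r c s hc h
    have hl : c.leadingCoeff ≠ 0 := leadingCoeff_ne_zero.2 hc
    have hll : (C c.leadingCoeff * C c.leadingCoeff⁻¹ : ℝ[X]) = 1 := by
      rw [← C_mul, mul_inv_cancel₀ hl, C_1]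
    refine ⟨c.leadingCoeff, c * C c.leadingCoeff⁻¹, monic_mul_leadingCoeff_inv hc, ?_, ?_, ?_⟩
    · linear_combination (-c) * hll
    · exact natDegree_mul_C (inv_ne_zero hl)
    · rw [derivative_mul, derivative_C]
      linear_combination C c.leadingCoeff⁻¹ * h
  obtain ⟨l, c, hc, hcl, hcd, hc'⟩ := norm _ _ _ _ (leadingCoeff_ne_zero.2 hP0) hA'
  obtain ⟨l', d, hd, hdl, hdd, hd'⟩ := norm _ _ _ _ (leadingCoeff_ne_zero.2 hS0) hB'
  have n1 := lead_deg hp1 hp2 hc hdp hc'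
  have n2 := lead_deg hq2 hq1 hd hdq hd'
  have le1 : c.natDegree ≤ S.natDegree := by
    rw [hcd]; exact natDegree_coeff_le_swap P _
  have le2 : d.natDegree ≤ P.natDegree := by
    rw [hdd]
    have := natDegree_coeff_le_swap S S.natDegree
    rwa [hS, Bivariate.swap_swap_apply, ← hS] at this
  obtain ⟨hm, -, -⟩ := lead_dy hy
  have hm' : (0 : ℝ) < P.natDegree := by exact_mod_cast hm
  have hkpos : 0 < k := by
    have : 0 ≤ k * P.natDegree := by rw [n1]; positivity
    have h3 : 0 ≤ k := nonneg_of_mul_nonneg_left this hm'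
    exact lt_of_le_of_ne h3 (Ne.symm hk)
  have n3 : (S.natDegree : ℝ) = k * d.natDegree := by rw [← n2]; field_simp
  have le3 : (P.natDegree : ℝ) ≤ d.natDegree := by
    have : k * (P.natDegree : ℝ) ≤ k * d.natDegree := by
      rw [n1, ← n3]; exact_mod_cast le1
    exact le_of_mul_le_mul_left this hkpos
  have le3' : P.natDegree ≤ d.natDegree := by exact_mod_cast le3
  have hdeq : d.natDegree = P.natDegree := le_antisymm le2 le3'
  refine ⟨c, d, l, ⟨hc, hd, ?_, ?_⟩, hdeq, hcl⟩
  · rw [hc', hdeq, C_mul]; ring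
  · rw [hd', n2]

/-- all product-type elements are powers of a minimal one -/
lemma eig_power {p1 p2 q1 q2 : ℝ[X]} {k : ℝ} (hp1 : p1 ≠ 0) (hq2 : q2 ≠ 0) {c0 d0 : ℝ[X]}
    (h0 : Eig p1 p2 q1 q2 k c0 d0) (hpos : 0 < d0.natDegree)
    (hmin : ∀ c d, Eig p1 p2 q1 q2 k c d → 0 < d.natDegree → d0.natDegree ≤ d.natDegree) :
    ∀ (n : ℕ) (c d : ℝ[X]), d.natDegree < n → Eig p1 p2 q1 q2 k c d →
      ∃ j : ℕ, c = c0 ^ j ∧ d = d0 ^ j := by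
  intro n
  induction n with
  | zero => intro c d h; omega
  | succ n ih =>
    intro c d hn h
    obtain ⟨hc, hd, e1, e2⟩ := h
    by_cases hz : d.natDegree = 0
    · refine ⟨0, ?_, ?_⟩
      · rw [hz] at e1
        simp only [Nat.cast_zero, C_0, zero_mul, mul_eq_zero, hp1, false_or] at e1
        rw [pow_zero]
        exact hc.natDegree_eq_zero.1 (derivative_eq_zero.1 e1)
      · rw [pow_zero]; exact hd.natDegree_eq_zero.1 hz
    · obtain ⟨hc0, hd0, f1, f2⟩ := h0
      have hle := hmin c d ⟨hc, hd, e1, e2⟩ (by omega)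
      have u1 := ode_pow hp1 hc hc0 e1 f1
      have u2 := ode_pow hq2 hd hd0 e2 f2
      have dv : ∀ f g : ℝ[X], f ^ d0.natDegree = g ^ d.natDegree → g ∣ f := by
        intro f g h
        rw [← UniqueFactorizationMonoid.pow_dvd_pow_iff_dvd (n := d0.natDegree) (by omega), h]
        exact pow_dvd_pow _ hle
      obtain ⟨c1, rfl⟩ := dv _ _ u1
      obtain ⟨d1, rfl⟩ := dv _ _ u2
      have hc1 : c1.Monic := hc0.of_mul_monic_left hc
      have hd1 : d1.Monic := hd0.of_mul_monic_left hd
      have hdeg : (d0 * d1).natDegree = d0.natDegree + d1.natDegree := hd0.natDegree_mul hd1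
      rw [hdeg, Nat.cast_add, C_add, derivative_mul] at e1 e2
      have hE : Eig p1 p2 q1 q2 k c1 d1 := by
        refine ⟨hc1, hd1, ?_, ?_⟩
        · apply mul_left_cancel₀ hc0.ne_zero
          linear_combination e1 - c1 * f1
        · apply mul_left_cancel₀ hd0.ne_zero
          linear_combination e2 - d1 * f2
      obtain ⟨j, j1, j2⟩ := ih c1 d1 (by omega) hE
      exact ⟨j + 1, by rw [j1, pow_succ']  , by rw [j2, pow_succ']⟩

/-- multiplicative case -/
lemma mult_case {p1 p2 q1 q2 : ℝ[X]} {k : ℝ} (hk : k ≠ 0)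
    (hp1 : p1.Monic) (hp2 : p2.Monic) (hq1 : q1.Monic) (hq2 : q2.Monic)
    (hp : IsCoprime p1 p2) (hq : IsCoprime q1 q2)
    (hdp : p1.natDegree = p2.natDegree + 1) (hdq : q2.natDegree = q1.natDegree + 1)
    {c0 d0 : ℝ[X]} (h0 : Eig p1 p2 q1 q2 k c0 d0) (hpos : 0 < d0.natDegree)
    (hmin : ∀ c d, Eig p1 p2 q1 q2 k c d → 0 < d.natDegree → d0.natDegree ≤ d.natDegree) :
    ∀ (n : ℕ) (P : ℝ[X][X]), P.natDegree < n → Ker p1 p2 q1 q2 k P →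
      ∃ f : ℝ[X], P = aeval (C c0 * d0.map C) f := by
  intro n
  induction n with
  | zero => intro P h; omega
  | succ n ih =>
    intro P hn hP
    have hq1m : (q1.map (C : ℝ →+* ℝ[X])).Monic := hq1.map _
    have hq2m : (q2.map (C : ℝ →+* ℝ[X])).Monic := hq2.map _
    have hkp : (C (C k * p2) : ℝ[X][X]) ≠ 0 := by
      rw [Ne, C_eq_zero]; exact mul_ne_zero (by simpa using hk) hp2.ne_zero
    have hp1' : (C p1 : ℝ[X][X]) ≠ 0 := by
      rw [Ne, C_eq_zero]; exact hp1.ne_zero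
    by_cases hy : derivative P = 0
    · have hx : dx P = 0 := by
        unfold Ker at hP
        rw [hy, mul_zero] at hP
        exact (mul_eq_zero.1 hP).resolve_left (mul_ne_zero hp1' hq1m.ne_zero)
      obtain ⟨a, ha⟩ := const_of_partials hx hy
      exact ⟨C a, by rw [ha, aeval_C]; rfl⟩
    have hx : dx P ≠ 0 := by
      intro hx
      unfold Ker at hP
      rw [hx, mul_zero] at hP
      exact (mul_ne_zero (mul_ne_zero hkp hq2m.ne_zero) hy) hP.symm
    obtain ⟨c, d, l, hE, hdeg, hl⟩ := eig_of_ker hk hp1 hp2 hq1 hq2 hp hq hdp hdq hP hx hy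
    obtain ⟨j, hj1, hj2⟩ := eig_power hp1.ne_zero hq2.ne_zero h0 hpos hmin _ c d
      (Nat.lt_succ_self _) hE
    set W0 := (C c0 * d0.map C : ℝ[X][X]) with hW0
    have hW : aeval W0 (C l * X ^ j) = C (C l * c) * d.map C := by
      rw [map_mul, aeval_C, map_pow, aeval_X, hW0, hj1, hj2, mul_pow, Polynomial.map_pow, C_mul, C_pow]
      change C (C l) * _ = _
      ring
    obtain ⟨hm, -, -⟩ := lead_dy hy
    have hP0 : P ≠ 0 := by rintro rfl; simp at hy
    have hdm : (d.map (C : ℝ →+* ℝ[X])).Monic := hE.2.1.map _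
    have hlc : (C l * c : ℝ[X]) ≠ 0 := by rw [← hl]; exact leadingCoeff_ne_zero.2 hP0
    have hWd : (aeval W0 (C l * X ^ j)).natDegree = P.natDegree := by
      rw [hW, natDegree_C_mul hlc, natDegree_map_eq_of_injective C_injective, hdeg]
    have hWl : (aeval W0 (C l * X ^ j)).leadingCoeff = P.leadingCoeff := by
      rw [hW, leadingCoeff_mul, leadingCoeff_C, hdm.leadingCoeff, mul_one, hl]
    have hKW : Ker p1 p2 q1 q2 k (aeval W0 (C l * X ^ j)) := h0.ker.aeval _
    have hlt : (P - aeval W0 (C l * X ^ j)).natDegree < n := by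
      by_cases hz : P - aeval W0 (C l * X ^ j) = 0
      · rw [hz, natDegree_zero]; omega
      have hW00 : aeval W0 (C l * X ^ j) ≠ 0 := by
        intro h; rw [h, leadingCoeff_zero] at hWl
        exact hP0 (leadingCoeff_eq_zero.1 hWl.symm)
      have := degree_sub_lt (by rw [degree_eq_natDegree hP0, degree_eq_natDegree hW00, hWd]) hP0 hWl.symm
      have := natDegree_lt_natDegree hz this
      omega
    obtain ⟨f, hf⟩ := ih _ hlt (hP.sub hKW)
    refine ⟨f + C l * X ^ j, ?_⟩
    rw [map_add, ← hf]; ring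

lemma mult_struct {p1 p2 q1 q2 : ℝ[X]} {k : ℝ} (hk : k ≠ 0)
    (hp1 : p1.Monic) (hp2 : p2.Monic) (hq1 : q1.Monic) (hq2 : q2.Monic)
    (hp : IsCoprime p1 p2) (hq : IsCoprime q1 q2)
    (hdp : p1.natDegree = p2.natDegree + 1) (hdq : q2.natDegree = q1.natDegree + 1)
    {P : ℝ[X][X]} (h : Ker p1 p2 q1 q2 k P) (hx : dx P ≠ 0) (hy : derivative P ≠ 0) :
    ∃ f c d : ℝ[X], P = aeval (C c * d.map C) f ∧ c.Monic ∧ d.Monic ∧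
      0 < c.natDegree ∧ 0 < d.natDegree ∧
      p1 * derivative c = C (c.natDegree : ℝ) * p2 * c ∧
      q2 * derivative d = C (d.natDegree : ℝ) * q1 * d := by
  classical
  have hex : ∃ m, 0 < m ∧ ∃ c d, Eig p1 p2 q1 q2 k c d ∧ d.natDegree = m := by
    obtain ⟨c, d, l, hE, hd, -⟩ := eig_of_ker hk hp1 hp2 hq1 hq2 hp hq hdp hdq h hx hy
    exact ⟨P.natDegree, (lead_dy hy).1, c, d, hE, hd⟩
  obtain ⟨hpos, c, d, hE, hd⟩ := Nat.find_spec hex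
  have hmin : ∀ c' d', Eig p1 p2 q1 q2 k c' d' → 0 < d'.natDegree → d.natDegree ≤ d'.natDegree := by
    intro c' d' h1 h2
    rw [hd]
    exact Nat.find_min' hex ⟨h2, c', d', h1, rfl⟩
  rw [← hd] at hpos
  obtain ⟨f, hf⟩ := mult_case hk hp1 hp2 hq1 hq2 hp hq hdp hdq hE hpos hmin _ P (Nat.lt_succ_self _) h
  obtain ⟨hc, hd', e1, e2⟩ := hE
  have e1' : p1 * derivative c = C ((d.natDegree : ℝ) * k) * p2 * c := by
    rw [e1, C_mul]; ring
  have := lead_deg hp1 hp2 hc hdp e1'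
  rw [this] at e1'
  refine ⟨f, c, d, hf, hc, hd', ?_, hpos, e1', e2⟩
  by_contra h0
  have h00 : c.natDegree = 0 := by omega
  rw [h00] at this
  have : (d.natDegree : ℝ) * k ≠ 0 := mul_ne_zero (by exact_mod_cast (by omega)) hk
  simp_all

lemma monic_coprime_norm (a b : ℝ[X]) (ha : a ≠ 0) (hb : b ≠ 0) :
    ∃ (g p r : ℝ[X]) (s : ℝ), g ≠ 0 ∧ s ≠ 0 ∧ p.Monic ∧ r.Monic ∧ IsCoprime p r ∧
      ∃ t : ℝ, t ≠ 0 ∧ a = g * (C t * p) ∧ b = g * (C s * r) := by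
  classical
  set g := EuclideanDomain.gcd a b with hg
  have hg0 : g ≠ 0 := by
    intro h
    rw [hg, EuclideanDomain.gcd_eq_zero_iff] at h
    exact ha h.1
  obtain ⟨a', ha'⟩ := EuclideanDomain.gcd_dvd_left a b
  obtain ⟨b', hb'⟩ := EuclideanDomain.gcd_dvd_right a b
  rw [← hg] at ha' hb'
  have hco : IsCoprime a' b' := by
    have := EuclideanDomain.gcd_eq_gcd_ab a b
    rw [← hg] at this
    refine ⟨EuclideanDomain.gcdA a b, EuclideanDomain.gcdB a b, ?_⟩
    apply mul_left_cancel₀ hg0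
    linear_combination (-1 : ℝ[X]) * this - EuclideanDomain.gcdA a b * ha' - EuclideanDomain.gcdB a b * hb'
  have ha0 : a' ≠ 0 := by rintro rfl; simp at ha'; exact ha ha'
  have hb0 : b' ≠ 0 := by rintro rfl; simp at hb'; exact hb hb'
  have nrm : ∀ c : ℝ[X], c ≠ 0 → c = C c.leadingCoeff * (c * C c.leadingCoeff⁻¹) := by
    intro c hc
    have : (C c.leadingCoeff * C c.leadingCoeff⁻¹ : ℝ[X]) = 1 := by
      rw [← C_mul, mul_inv_cancel₀ (leadingCoeff_ne_zero.2 hc), C_1]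
    linear_combination (-c) * this
  refine ⟨g, a' * C a'.leadingCoeff⁻¹, b' * C b'.leadingCoeff⁻¹, b'.leadingCoeff, hg0,
    leadingCoeff_ne_zero.2 hb0, monic_mul_leadingCoeff_inv ha0, monic_mul_leadingCoeff_inv hb0, ?_,
    a'.leadingCoeff, leadingCoeff_ne_zero.2 ha0, ?_, ?_⟩
  · have u1 : IsUnit (C a'.leadingCoeff⁻¹ : ℝ[X]) :=
      isUnit_C.2 (IsUnit.mk0 _ (inv_ne_zero (leadingCoeff_ne_zero.2 ha0)))
    have u2 : IsUnit (C b'.leadingCoeff⁻¹ : ℝ[X]) :=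
      isUnit_C.2 (IsUnit.mk0 _ (inv_ne_zero (leadingCoeff_ne_zero.2 hb0)))
    exact (isCoprime_mul_unit_right_left u1 _ _).2 ((isCoprime_mul_unit_right_right u2 _ _).2 hco)
  · rw [← nrm a' ha0, ← ha']
  · rw [← nrm b' hb0, ← hb']

lemma sep_lemma (A B A' B' : ℝ[X][X]) (hA : A ≠ 0) (hB : B ≠ 0) (hA' : A' ≠ 0) (hB' : B' ≠ 0)
    (h1 : ∀ a a' b b', A.evalEval a b * B.evalEval a' b * A'.evalEval a' b' * B'.evalEval a b' =
      A.evalEval a' b * B.evalEval a b * A'.evalEval a b' * B'.evalEval a' b')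
    (h2 : ∀ a a' b b', B.evalEval b a * A.evalEval b a' * B'.evalEval b' a' * A'.evalEval b' a =
      B.evalEval b a' * A.evalEval b a * B'.evalEval b' a * A'.evalEval b' a') :
    ∃ (p1 p2 q1 q2 : ℝ[X]) (k k' : ℝ), p1.Monic ∧ p2.Monic ∧ q1.Monic ∧ q2.Monic ∧
      IsCoprime p1 p2 ∧ IsCoprime q1 q2 ∧ k ≠ 0 ∧ k' ≠ 0 ∧
      C p1 * q1.map C * A = C (C k * p2) * q2.map C * B ∧
      C p1 * q1.map C * A' = C (C k' * p2) * q2.map C * B' := by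
  obtain ⟨x0, y0, h0⟩ : ∃ x y, (A * B * (A' * B')).evalEval x y ≠ 0 := by
    by_contra hcon
    push Not at hcon
    have : A * B * (A' * B') = 0 := evalEval_ext (by simpa using hcon)
    exact (mul_ne_zero (mul_ne_zero hA hB) (mul_ne_zero hA' hB')) this
  simp only [evalEval_mul, ne_eq, mul_eq_zero, not_or] at h0
  obtain ⟨⟨hA0, hB0⟩, hA0', hB0'⟩ := h0
  -- separated polynomials
  set a1 : ℝ[X] := C (A'.evalEval x0 y0) * B'.eval (C y0) with ha1
  set a2 : ℝ[X] := C (B'.evalEval x0 y0) * A'.eval (C y0) with ha2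
  set b1 : ℝ[X] := B.map (evalRingHom x0) with hb1
  set b2 : ℝ[X] := A.map (evalRingHom x0) with hb2
  have ea1 : ∀ x, a1.eval x = A'.evalEval x0 y0 * B'.evalEval x y0 := by
    intro x; rw [ha1, eval_mul, eval_C]; try rfl
  have ea2 : ∀ x, a2.eval x = B'.evalEval x0 y0 * A'.evalEval x y0 := by
    intro x; rw [ha2, eval_mul, eval_C]; try rfl
  have eb1 : ∀ y, b1.eval y = B.evalEval x0 y := by
    intro y; rw [hb1, map_evalRingHom_eval]
  have eb2 : ∀ y, b2.eval y = A.evalEval x0 y := by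
    intro y; rw [hb2, map_evalRingHom_eval]
  have nz : ∀ (p : ℝ[X]) (t : ℝ), p.eval t ≠ 0 → p ≠ 0 := by
    rintro p t h rfl; simp at h
  have na1 : a1 ≠ 0 := nz _ x0 (by rw [ea1]; exact mul_ne_zero hA0' hB0')
  have na2 : a2 ≠ 0 := nz _ x0 (by rw [ea2]; exact mul_ne_zero hB0' hA0')
  have nb1 : b1 ≠ 0 := nz _ y0 (by rw [eb1]; exact hB0)
  have nb2 : b2 ≠ 0 := nz _ y0 (by rw [eb2]; exact hA0)
  have K1 : C a1 * b1.map C * A = C a2 * b2.map C * B := by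
    apply evalEval_ext
    intro x y
    simp only [evalEval_mul, evalEval_C, evalEval_map_C, ea1, ea2, eb1, eb2]
    linear_combination h1 x x0 y y0
  set al := A.evalEval x0 y0 * B'.evalEval x0 y0 with hal
  set be := B.evalEval x0 y0 * A'.evalEval x0 y0 with hbe
  have nal : al ≠ 0 := mul_ne_zero hA0 hB0'
  have nbe : be ≠ 0 := mul_ne_zero hB0 hA0'
  have K2 : C (C be) * (A * B') = C (C al) * (B * A') := by
    have t0 : ((B.map (evalRingHom x0) * A'.map (evalRingHom x0)).map C : ℝ[X][X]) ≠ 0 := by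
      rw [Ne, Polynomial.map_eq_zero_iff C_injective]
      apply nz _ y0
      rw [eval_mul, map_evalRingHom_eval, map_evalRingHom_eval]
      exact mul_ne_zero hB0 hA0'
    apply mul_left_cancel₀ t0
    apply evalEval_ext
    intro x y
    simp only [evalEval_mul, evalEval_C, evalEval_map_C, eval_mul, map_evalRingHom_eval, eval_C]
    have e1 := h1 x x0 y y
    have e2 := h2 y y0 x0 x0
    linear_combination be * e1 - (B.evalEval x y * A'.evalEval x y) * e2
  have K3 : C (C al) * (C a1 * b1.map C * A') = C (C be) * (C a2 * b2.map C * B') := by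
    apply mul_left_cancel₀ hB
    linear_combination (-(C a1 * b1.map C)) * K2 + (C (C be) * B') * K1
  obtain ⟨g, p1, p2, s, hg, hs, hp1, hp2, hp, t, ht, r1, r2⟩ := monic_coprime_norm a1 a2 na1 na2
  obtain ⟨g', q1, q2, s', hg', hs', hq1, hq2, hq, t', ht', r1', r2'⟩ := monic_coprime_norm b1 b2 nb1 nb2
  have hG : (C g * g'.map C : ℝ[X][X]) ≠ 0 :=
    mul_ne_zero (by simpa using hg) (by rwa [Ne, Polynomial.map_eq_zero_iff C_injective])
  rw [r1, r2, r1', r2'] at K1 K3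
  simp only [C_mul, Polynomial.map_mul, Polynomial.map_C] at K1 K3
  have hu : (C (C (t * t')⁻¹) * (C (C t) * C (C t')) : ℝ[X][X]) = 1 := by
    rw [← C_mul, ← C_mul, ← C_mul, ← C_mul, inv_mul_cancel₀ (mul_ne_zero ht ht'), C_1, C_1]
  have hv : (C (C al⁻¹) * C (C al) : ℝ[X][X]) = 1 := by
    rw [← C_mul, ← C_mul, inv_mul_cancel₀ nal, C_1, C_1]
  refine ⟨p1, p2, q1, q2, (t * t')⁻¹ * (s * s'), al⁻¹ * be * ((t * t')⁻¹ * (s * s')), hp1, hp2, hq1, hq2, hp, hq,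
    mul_ne_zero (inv_ne_zero (mul_ne_zero ht ht')) (mul_ne_zero hs hs'),
    mul_ne_zero (mul_ne_zero (inv_ne_zero nal) nbe)
      (mul_ne_zero (inv_ne_zero (mul_ne_zero ht ht')) (mul_ne_zero hs hs')), ?_, ?_⟩
  · apply mul_left_cancel₀ hG
    simp only [C_mul] at hu ⊢
    linear_combination (C (C (t * t')⁻¹)) * K1 - (C g * g'.map C * C p1 * q1.map C * A) * hu
  · apply mul_left_cancel₀ hG
    simp only [C_mul] at hu ⊢
    linear_combination (C (C (t * t')⁻¹) * C (C al⁻¹)) * K3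
      - (C g * g'.map C * C p1 * q1.map C * A') * hu
      - (C (C (t * t')⁻¹) * (C (C t) * C (C t')) * C g * g'.map C * C p1 * q1.map C * A') * hv

lemma equivM_of_pow {u v : ℝ[X]} {a b : ℕ} (ha : 0 < a) (hb : 0 < b) (h : u ^ b = v ^ a) :
    EquivM u v := by
  refine ⟨(a : ℚ) / b, by positivity, ?_⟩
  intro x
  have h1 := congrArg (fun t => |t.eval x|) h
  simp only [eval_pow, abs_pow] at h1
  have hb' : (b : ℝ) ≠ 0 := by positivity
  push_cast
  rw [div_eq_mul_inv, Real.rpow_mul (abs_nonneg _), Real.rpow_natCast, ← h1,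
    Real.pow_rpow_inv_natCast (abs_nonneg _) (by omega)]

lemma f_nonconst {W P : ℝ[X][X]} {f : ℝ[X]} (h : P = aeval W f) (hx : dx P ≠ 0) : 0 < f.natDegree := by
  apply natDegree_pos_of_deriv
  intro h0
  apply hx
  rw [h, dx_aeval, h0, map_zero, zero_mul]

/-- the structural conclusion -/
def StructConcl (P Q : ℝ → ℝ → ℝ) : Prop :=
  (∃ f g u₁ u₂ v₁ v₂ : Polynomial ℝ,
              0 < f.natDegree ∧ 0 < g.natDegree ∧
              0 < u₁.natDegree ∧ 0 < u₂.natDegree ∧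
              0 < v₁.natDegree ∧ 0 < v₂.natDegree ∧
              (∀ x y : ℝ, P x y = f.eval (u₁.eval x + u₂.eval y)) ∧
              (∀ x y : ℝ, Q x y = g.eval (v₁.eval x + v₂.eval y)) ∧
              EquivA u₁ v₁ ∧ EquivA u₂ v₂) ∨
  (∃ f g u₁ u₂ v₁ v₂ : Polynomial ℝ,
              0 < f.natDegree ∧ 0 < g.natDegree ∧
              0 < u₁.natDegree ∧ 0 < u₂.natDegree ∧
              0 < v₁.natDegree ∧ 0 < v₂.natDegree ∧
              (∀ x y : ℝ, P x y = f.eval (u₁.eval x * u₂.eval y)) ∧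
              (∀ x y : ℝ, Q x y = g.eval (v₁.eval x * v₂.eval y)) ∧
              EquivM u₁ v₁ ∧ EquivM u₂ v₂)

lemma struct_main (P Q : ℝ[X][X]) (hA : dx P ≠ 0) (hB : derivative P ≠ 0) (hA' : dx Q ≠ 0)
    (hB' : derivative Q ≠ 0)
    (h1 : ∀ a a' b b', (dx P).evalEval a b * (derivative P).evalEval a' b *
        (dx Q).evalEval a' b' * (derivative Q).evalEval a b' =
      (dx P).evalEval a' b * (derivative P).evalEval a b *
        (dx Q).evalEval a b' * (derivative Q).evalEval a' b')
    (h2 : ∀ a a' b b', (derivative P).evalEval b a * (dx P).evalEval b a' *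
        (derivative Q).evalEval b' a' * (dx Q).evalEval b' a =
      (derivative P).evalEval b a' * (dx P).evalEval b a *
        (derivative Q).evalEval b' a * (dx Q).evalEval b' a') :
    StructConcl (fun x y => P.evalEval x y) (fun x y => Q.evalEval x y) := by
  obtain ⟨p1, p2, q1, q2, k, k', hp1, hp2, hq1, hq2, hp, hq, hk, hk', hKP, hKQ⟩ :=
    sep_lemma _ _ _ _ hA hB hA' hB' h1 h2
  change Ker p1 p2 q1 q2 k P at hKP
  change Ker p1 p2 q1 q2 k' Q at hKQ
  have hxS : dx (Bivariate.swap P) ≠ 0 := by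
    rw [dx_swap]; simpa only [ne_eq, EmbeddingLike.map_eq_zero_iff] using hB
  have hyS : derivative (Bivariate.swap P) ≠ 0 := by
    rw [dy_swap]; simpa only [ne_eq, EmbeddingLike.map_eq_zero_iff] using hA
  have c1 := lead_cmp hk hp1 hp2 hq1 hq2 hp hKP hA hB
  have c2 := lead_cmp (inv_ne_zero hk) hq2 hq1 hp2 hp1 hq.symm (hKP.swap hk) hxS hyS
  rcases c1 with ⟨d1, -⟩ | ⟨d1, e1⟩
  · rcases c2 with ⟨d2, -⟩ | ⟨d2, e2⟩
    · right
      obtain ⟨f, u1, u2, hf, mu1, mu2, pu1, pu2, o1, o2⟩ :=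
        mult_struct hk hp1 hp2 hq1 hq2 hp hq d2 d1 hKP hA hB
      obtain ⟨g, v1, v2, hg, mv1, mv2, pv1, pv2, o3, o4⟩ :=
        mult_struct hk' hp1 hp2 hq1 hq2 hp hq d2 d1 hKQ hA' hB'
      refine ⟨f, g, u1, u2, v1, v2, f_nonconst hf hA, f_nonconst hg hA', pu1, pu2, pv1, pv2, ?_, ?_,
        equivM_of_pow pu1 pv1 (ode_pow hp1.ne_zero mu1 mv1 o1 o3),
        equivM_of_pow pu2 pv2 (ode_pow hq2.ne_zero mu2 mv2 o2 o4)⟩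
      · intro x y
        simp only
        rw [hf, evalEval_aeval]; simp [evalEval_mul, evalEval_C, evalEval_map_C]
      · intro x y
        simp only
        rw [hg, evalEval_aeval]; simp [evalEval_mul, evalEval_C, evalEval_map_C]
    · rw [e2] at d1; simp at d1
  · rcases c2 with ⟨d2, -⟩ | ⟨d2, e2⟩
    · rw [e1] at d2; simp at d2
    · left
      subst e1 e2
      obtain ⟨U, hU⟩ := exists_antideriv p2
      obtain ⟨V, hV⟩ := exists_antideriv q1
      have hU1 : ∀ s : ℝ, derivative (C s * U) = C s * p2 := by
        intro s; rw [derivative_C_mul, hU]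
      obtain ⟨f, hf⟩ := additive_case hk hp2.ne_zero hq1 (hU1 k) hV _ P (Nat.lt_succ_self _) hKP
      obtain ⟨g, hg⟩ := additive_case hk' hp2.ne_zero hq1 (hU1 k') hV _ Q (Nat.lt_succ_self _) hKQ
      have hUp : ∀ s : ℝ, s ≠ 0 → 0 < (C s * U).natDegree := by
        intro s hs
        apply natDegree_pos_of_deriv
        rw [hU1]
        exact mul_ne_zero (by simpa using hs) hp2.ne_zero
      have hVp : 0 < V.natDegree := natDegree_pos_of_deriv _ (by rw [hV]; exact hq1.ne_zero)
      refine ⟨f, g, C k * U, V, C k' * U, V, f_nonconst hf hA, f_nonconst hg hA', hUp k hk, hVp,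
        hUp k' hk', hVp, ?_, ?_, ⟨k / k', div_ne_zero hk hk', ?_⟩, ⟨1, one_ne_zero, by simp⟩⟩
      · intro x y
        simp only
        rw [hf, evalEval_aeval]; simp [evalEval_add, evalEval_C, evalEval_map_C]
      · intro x y
        simp only
        rw [hg, evalEval_aeval]; simp [evalEval_add, evalEval_C, evalEval_map_C]
      · intro x
        simp only [eval_mul, eval_C]
        field_simp

lemma ev_equiv (P : ℝ[X][X]) (x y : ℝ) :
    MvPolynomial.eval ![x, y] (Bivariate.equivMvPolynomial ℝ P) = P.evalEval x y := by
  induction P using Polynomial.induction_on' with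
  | add p q hp hq => rw [map_add, map_add, evalEval_add, hp, hq]
  | monomial n p =>
    induction p using Polynomial.induction_on' with
    | add p q hp hq => rw [map_add, map_add, map_add, evalEval_add, hp, hq]
    | monomial m a =>
      simp_rw [← Polynomial.C_mul_X_pow_eq_monomial]
      simp [evalEval_mul, evalEval_pow, evalEval_C]

theorem stmt12 (δ : ℕ) :
    ∃ c : ℝ, 0 < c ∧
      ∀ P Q : MvPolynomial (Fin 2) ℝ,
        P.totalDegree ≤ δ → Q.totalDegree ≤ δ →
        1 ≤ P.degreeOf 0 → 1 ≤ P.degreeOf 1 →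
        1 ≤ Q.degreeOf 0 → 1 ≤ Q.degreeOf 1 →
        ¬ (∃ f g u₁ u₂ v₁ v₂ : Polynomial ℝ,
              0 < f.natDegree ∧ 0 < g.natDegree ∧
              0 < u₁.natDegree ∧ 0 < u₂.natDegree ∧
              0 < v₁.natDegree ∧ 0 < v₂.natDegree ∧
              (∀ x y : ℝ, MvPolynomial.eval ![x, y] P = f.eval (u₁.eval x + u₂.eval y)) ∧
              (∀ x y : ℝ, MvPolynomial.eval ![x, y] Q = g.eval (v₁.eval x + v₂.eval y)) ∧
              EquivA u₁ v₁ ∧ EquivA u₂ v₂) →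
        ¬ (∃ f g u₁ u₂ v₁ v₂ : Polynomial ℝ,
              0 < f.natDegree ∧ 0 < g.natDegree ∧
              0 < u₁.natDegree ∧ 0 < u₂.natDegree ∧
              0 < v₁.natDegree ∧ 0 < v₂.natDegree ∧
              (∀ x y : ℝ, MvPolynomial.eval ![x, y] P = f.eval (u₁.eval x * u₂.eval y)) ∧
              (∀ x y : ℝ, MvPolynomial.eval ![x, y] Q = g.eval (v₁.eval x * v₂.eval y)) ∧
              EquivM u₁ v₁ ∧ EquivM u₂ v₂) →
        ∀ (n : ℕ) (A B : Finset ℝ), A.card = n → B.card = n →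
          c * (n : ℝ) ^ ((5 : ℝ) / 4) ≤
            max
              (((A ×ˢ B).image fun ab => MvPolynomial.eval ![ab.1, ab.2] P).card : ℝ)
              (((A ×ˢ B).image fun ab => MvPolynomial.eval ![ab.1, ab.2] Q).card : ℝ) := by
  obtain ⟨c, hc, hred⟩ := reduction δ
  refine ⟨c, hc, ?_⟩
  intro P Q hP hQ hP0 hP1 hQ0 hQ1 hi hii
  have nP0 := pderiv_ne P 0 hP0
  have nP1 := pderiv_ne P 1 hP1
  have nQ0 := pderiv_ne Q 0 hQ0
  have nQ1 := pderiv_ne Q 1 hQ1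
  rcases hred P Q hP hQ nP0 nP1 nQ0 nQ1 with h | ⟨h1, h2⟩
  · exact h
  exfalso
  obtain ⟨P', rfl⟩ := (Bivariate.equivMvPolynomial ℝ).surjective P
  obtain ⟨Q', rfl⟩ := (Bivariate.equivMvPolynomial ℝ).surjective Q
  have d0 : ∀ R : ℝ[X][X], MvPolynomial.pderiv 0 (Bivariate.equivMvPolynomial ℝ R) =
      Bivariate.equivMvPolynomial ℝ (dx R) := fun R => Bivariate.pderiv_zero_equivMvPolynomial R
  have d1 : ∀ R : ℝ[X][X], MvPolynomial.pderiv 1 (Bivariate.equivMvPolynomial ℝ R) =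
      Bivariate.equivMvPolynomial ℝ (derivative R) :=
    fun R => Bivariate.pderiv_one_equivMvPolynomial R
  rw [d0, Ne, EmbeddingLike.map_eq_zero_iff] at nP0 nQ0
  rw [d1, Ne, EmbeddingLike.map_eq_zero_iff] at nP1 nQ1
  simp only [d0, d1, ev, ev_equiv] at h1 h2
  simp only [ev_equiv] at hi hii
  rcases struct_main P' Q' nP0 nP1 nQ0 nQ1 h1 h2 with h | h
  · exact hi h
  · exact hii h
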